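/- Let G be a countable infinite discrete amenable group, and let (A, α) be an arbitrary unital Kirchberg algebra with a point-wise outer G-action α. Then there exists an α-cocycle (u_g)_{g∈G} of unitaries in A such that the cocycle-perturbed action α^u, defined by (α^u)_g := Ad u_g ∘ α_g for g ∈ G, is ergodic. -/

import Mathlib

/-!  Common definitions: group actions on C*-algebras, ergodicity, outerness,
states, conditional expectations, nuclearity, Kirchberg algebras, amenability. -/

noncomputable section

open scoped ComplexOrder MultiplierAlgebra

/-- An action of a group `G` on a (star) algebra `A` by ⋆-algebra automorphisms. -/
structure CStarAction (G A : Type) [Group G] [Add A] [Mul A] [SMul ℂ A] [Star A] where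
  app : G → A ≃⋆ₐ[ℂ] A
  app_one : ∀ a : A, app 1 a = a
  app_mul : ∀ (g h : G) (a : A), app (g * h) a = app g (app h a)

/-- The trivial action of `G` on `A`. -/
def trivialCStarAction (G A : Type) [Group G] [Add A] [Mul A] [SMul ℂ A] [Star A] :
    CStarAction G A where
  app _ := StarAlgEquiv.refl ℂ A
  app_one _ := rfl
  app_mul _ _ _ := rfl

/-- An automorphism of a unital C*-algebra is inner if it is `Ad u` for a unitary `u`. -/
def IsInnerAut {A : Type} [CStarAlgebra A] (φ : A ≃⋆ₐ[ℂ] A) : Prop :=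
  ∃ u : A, u ∈ unitary A ∧ ∀ a : A, φ a = u * a * star u

/-- The fixed point set of an action. -/
def CStarAction.fixedPoints {G A : Type} [Group G] [Add A] [Mul A] [SMul ℂ A] [Star A]
    (α : CStarAction G A) : Set A :=
  {a : A | ∀ g : G, α.app g a = a}

/-- An action on a unital C*-algebra is ergodic if its fixed point algebra is `ℂ1`. -/
def CStarAction.IsErgodic {G A : Type} [Group G] [CStarAlgebra A]
    (α : CStarAction G A) : Prop :=
  α.fixedPoints = Set.range (fun z : ℂ => z • (1 : A))

/-- An action is point-wise outer if `α g` is not inner for every `g ≠ 1`. -/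
def CStarAction.IsPointwiseOuter {G A : Type} [Group G] [CStarAlgebra A]
    (α : CStarAction G A) : Prop :=
  ∀ g : G, g ≠ 1 → ¬ IsInnerAut (α.app g)

/-- A state on a unital C*-algebra. -/
structure IsState {A : Type} [CStarAlgebra A] (φ : A →ₗ[ℂ] ℂ) : Prop where
  map_one : φ 1 = 1
  pos : ∀ a : A, 0 ≤ φ (star a * a)

/-- A `G`-invariant state. -/
structure IsInvariantState {G A : Type} [Group G] [CStarAlgebra A]
    (α : CStarAction G A) (φ : A →ₗ[ℂ] ℂ) extends IsState φ : Prop where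
  invariant : ∀ (g : G) (a : A), φ (α.app g a) = φ a

/-- A conditional expectation of `A` onto the subalgebra (given as the subset) `S`. -/
structure IsConditionalExpectation {A : Type} [NonUnitalCStarAlgebra A]
    (P : A →ₗ[ℂ] A) (S : Set A) : Prop where
  mem : ∀ a : A, P a ∈ S
  fixes : ∀ a ∈ S, P a = a
  contractive : ∀ a : A, ‖P a‖ ≤ ‖a‖
  positive : ∀ a : A, ∃ b : A, P (star a * a) = star b * b
  left_module : ∀ b ∈ S, ∀ a : A, P (b * a) = b * P a
  right_module : ∀ b ∈ S, ∀ a : A, P (a * b) = P a * b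

/-- Complete positivity of a linear map between star algebras (positivity of all
matrix amplifications, where positivity is witnessed algebraically). -/
def IsCompletelyPositive {A B : Type} [NonUnitalRing A] [StarRing A] [Module ℂ A]
    [NonUnitalRing B] [StarRing B] [Module ℂ B] (φ : A →ₗ[ℂ] B) : Prop :=
  ∀ (n : ℕ) (M : Matrix (Fin n) (Fin n) A), (∃ N : Matrix (Fin n) (Fin n) A, M = N.conjTranspose * N) →
    ∃ N' : Matrix (Fin n) (Fin n) B, M.map φ = N'.conjTranspose * N'

/-- Nuclearity of a C*-algebra, via the completely positive approximation property. -/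
def IsNuclearCStar (A : Type) [NonUnitalCStarAlgebra A] : Prop :=
  ∀ (s : Finset A) (ε : ℝ), 0 < ε →
    ∃ (n : ℕ) (φ : A →ₗ[ℂ] Matrix (Fin n) (Fin n) ℂ) (ψ : Matrix (Fin n) (Fin n) ℂ →ₗ[ℂ] A),
      IsCompletelyPositive φ ∧ IsCompletelyPositive ψ ∧ ∀ a ∈ s, ‖ψ (φ a) - a‖ < ε

/-- Simplicity: no non-trivial closed two-sided ideals (and `A ≠ 0`). -/
def IsSimpleCStarAlgebra (A : Type) [NonUnitalCStarAlgebra A] : Prop :=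
  (∃ a : A, a ≠ 0) ∧
    ∀ I : TwoSidedIdeal A, IsClosed (I : Set A) → (I : Set A) = {0} ∨ (I : Set A) = Set.univ

/-- A unital Kirchberg algebra: separable, nuclear, simple, purely infinite (UCT not assumed). -/
structure IsUnitalKirchberg (A : Type) [CStarAlgebra A] : Prop where
  separable : TopologicalSpace.SeparableSpace A
  nuclear : IsNuclearCStar A
  simple : IsSimpleCStarAlgebra A
  properly_infinite : ∃ s t : A, star s * s = 1 ∧ star t * t = 1 ∧ star s * t = 0
  purely_infinite : ∀ a : A, a ≠ 0 → ∃ x y : A, x * a * y = 1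

/-- A (possibly non-unital) Kirchberg algebra. -/
structure IsKirchberg (A : Type) [NonUnitalCStarAlgebra A] : Prop where
  separable : TopologicalSpace.SeparableSpace A
  nuclear : IsNuclearCStar A
  simple : IsSimpleCStarAlgebra A
  purely_infinite : ∀ a b : A, a ≠ 0 → ∀ ε : ℝ, 0 < ε → ∃ x y : A, ‖x * a * y - b‖ < ε

/-- Amenability of a discrete group: existence of a left invariant finitely additive mean. -/
def IsAmenableGroup (G : Type) [Group G] : Prop :=
  ∃ m : Set G → ℝ, (∀ s, 0 ≤ m s) ∧ m Set.univ = 1 ∧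
    (∀ s t : Set G, Disjoint s t → m (s ∪ t) = m s + m t) ∧
    ∀ (g : G) (s : Set G), m ((g * ·) '' s) = m s

/-- A projection in a C*-algebra. -/
def IsProjectionElem {A : Type} [NonUnitalCStarAlgebra A] (p : A) : Prop :=
  star p = p ∧ p * p = p

/-- An approximate unit consisting of a strictly increasing sequence of projections. -/
def HasIncreasingProjApproxUnit (A : Type) [NonUnitalCStarAlgebra A] : Prop :=
  ∃ p : ℕ → A, (∀ n, IsProjectionElem (p n)) ∧
    (∀ n, p n * p (n + 1) = p n ∧ p (n + 1) * p n = p n ∧ p n ≠ p (n + 1)) ∧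
    ∀ x : A, Filter.Tendsto (fun n => ‖x - p n * x‖ + ‖x - x * p n‖) Filter.atTop (nhds 0)

/-- `A` has a unit. -/
def IsUnitalAlgebra (A : Type) [NonUnitalCStarAlgebra A] : Prop :=
  ∃ e : A, ∀ x : A, e * x = x ∧ x * e = x

end
noncomputable section

open scoped MultiplierAlgebra

/-- A bundled C*-algebra with an action of the group `G` (a "G-C*-algebra"). -/
structure GCStar (G : Type) [Group G] where
  carrier : Type
  [inst : NonUnitalCStarAlgebra carrier]
  act : CStarAction G carrier

attribute [instance] GCStar.inst

/-- A `G`-equivariant ⋆-homomorphism between G-C*-algebras. -/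
structure GHom (G : Type) [Group G] (A B : GCStar G) where
  hom : A.carrier →⋆ₙₐ[ℂ] B.carrier
  equivariant : ∀ (g : G) (a : A.carrier), hom (A.act.app g a) = B.act.app g (hom a)

namespace GHom

variable {G : Type} [Group G]

/-- The identity equivariant homomorphism. -/
def id (A : GCStar G) : GHom G A A where
  hom :=
    { toFun := fun a => a
      map_smul' := fun _ _ => rfl
      map_zero' := rfl
      map_add' := fun _ _ => rfl
      map_mul' := fun _ _ => rfl
      map_star' := fun _ => rfl }
  equivariant _ _ := rfl

/-- Composition (in diagrammatic order: `f.comp g = g ∘ f`). -/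
def comp {A B C : GCStar G} (f : GHom G A B) (g : GHom G B C) : GHom G A C where
  hom := g.hom.comp f.hom
  equivariant h a := by
    simp only [NonUnitalStarAlgHom.comp_apply, f.equivariant, g.equivariant]

end GHom

/-- Forget the `G`-action, yielding an object over the trivial group `PUnit`. -/
def GCStar.forget {G : Type} [Group G] (A : GCStar G) : GCStar PUnit :=
  { carrier := A.carrier, inst := A.inst, act := trivialCStarAction PUnit A.carrier }

/-- Forget equivariance of a morphism. -/
def GHom.forget {G : Type} [Group G] {A B : GCStar G} (f : GHom G A B) :
    GHom PUnit A.forget B.forget :=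
  { hom := f.hom, equivariant := fun _ _ => rfl }

/-- An (abstract) equivariant Kasparov `KK^G`-theory: a category structure on
G-C*-algebras whose morphisms are the `KK^G`-groups, receiving equivariant
⋆-homomorphisms and classes of cocycle morphisms, together with suspension, Bott
periodicity, mapping cones and exact triangles. -/
structure KKTheoryG (G : Type) [Group G] where
  KK : GCStar G → GCStar G → Type
  instAddCommGroup : ∀ A B, AddCommGroup (KK A B)
  unit : (A : GCStar G) → KK A A
  comp : {A B C : GCStar G} → KK A B → KK B C → KK A C
  ofHom : {A B : GCStar G} → GHom G A B → KK A B
  ofCocycle : {A B : GCStar G} → (A.carrier →⋆ₙₐ[ℂ] B.carrier) →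
    (G → 𝓜(ℂ, B.carrier)) → KK A B
  comp_assoc : ∀ {A B C D : GCStar G} (x : KK A B) (y : KK B C) (z : KK C D),
    comp (comp x y) z = comp x (comp y z)
  unit_comp : ∀ {A B : GCStar G} (x : KK A B), comp (unit A) x = x
  comp_unit : ∀ {A B : GCStar G} (x : KK A B), comp x (unit B) = x
  ofHom_id : ∀ A : GCStar G, ofHom (GHom.id A) = unit A
  ofHom_comp : ∀ {A B C : GCStar G} (f : GHom G A B) (g : GHom G B C),
    ofHom (f.comp g) = comp (ofHom f) (ofHom g)
  ofCocycle_one : ∀ {A B : GCStar G} (f : GHom G A B),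
    ofCocycle f.hom (fun _ => 1) = ofHom f
  susp : GCStar G → GCStar G
  suspGHom : {A B : GCStar G} → GHom G A B → GHom G (susp A) (susp B)
  suspKK : {A B : GCStar G} → KK A B → KK (susp A) (susp B)
  bott : (A : GCStar G) → KK A (susp (susp A))
  bott_invertible : ∀ A : GCStar G,
    ∃ y : KK (susp (susp A)) A, comp (bott A) y = unit A ∧ comp y (bott A) = unit (susp (susp A))
  cone : {A B : GCStar G} → GHom G A B → GCStar G
  coneEval : {A B : GCStar G} → (f : GHom G A B) → GHom G (cone f) A
  coneIota : {A B : GCStar G} → (f : GHom G A B) → KK (susp B) (cone f)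
  coneJ : {A B J : GCStar G} → (f : GHom G A B) → (l : GHom G J A) →
    (∀ x, f.hom (l.hom x) = 0) → KK J (cone f)
  exactTriangle : {X A B : GCStar G} → KK (susp X) A → KK A B → KK B X → Prop
  triangle_cone : ∀ {A B : GCStar G} (f : GHom G A B),
    exactTriangle (coneIota f) (ofHom (coneEval f)) (ofHom f)

attribute [instance] KKTheoryG.instAddCommGroup

namespace KKTheoryG

variable {G : Type} [Group G]

/-- A class is a `KK^G`-equivalence if it is invertible for the Kasparov product. -/
def IsEquiv (kk : KKTheoryG G) {A B : GCStar G} (x : kk.KK A B) : Prop :=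
  ∃ y : kk.KK B A, kk.comp x y = kk.unit A ∧ kk.comp y x = kk.unit B

end KKTheoryG

/-- Non-equivariant `KK`-theory, seen as `KK`-theory over the trivial group. -/
abbrev KKTheory := KKTheoryG PUnit

/-- The forgetful functor `F : KK^G → KK`. -/
structure KKForget {G : Type} [Group G] (kkG : KKTheoryG G) (kk : KKTheory) where
  map : ∀ {A B : GCStar G}, kkG.KK A B → kk.KK A.forget B.forget
  map_ofHom : ∀ {A B : GCStar G} (f : GHom G A B), map (kkG.ofHom f) = kk.ofHom f.forget
  map_comp : ∀ {A B C : GCStar G} (x : kkG.KK A B) (y : kkG.KK B C),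
    map (kkG.comp x y) = kk.comp (map x) (map y)
  map_unit : ∀ A : GCStar G, map (kkG.unit A) = kk.unit A.forget

/-- The unital homomorphism `ℂ → A`, `z ↦ z • 1`. -/
def unitHomC (A : Type) [CStarAlgebra A] : ℂ →⋆ₙₐ[ℂ] A where
  toFun z := z • (1 : A)
  map_smul' z w := by simp [smul_smul]
  map_zero' := by simp
  map_add' z w := by simp [add_smul]
  map_mul' z w := by
    simp [smul_smul, smul_mul_smul_comm, mul_comm]
  map_star' z := by simp [star_smul, RCLike.star_def]

/-- Bundle an algebra with an action as a G-C*-algebra. -/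
abbrev GCStar.of (G : Type) [Group G] (A : Type) [NonUnitalCStarAlgebra A]
    (α : CStarAction G A) : GCStar G :=
  { carrier := A, act := α }

/-- `ℂ` as a G-C*-algebra with the trivial action. -/
abbrev GCStar.C (G : Type) [Group G] : GCStar G :=
  GCStar.of G ℂ (trivialCStarAction G ℂ)

lemma StarAlgEquiv.map_one' {A : Type} [CStarAlgebra A] (e : A ≃⋆ₐ[ℂ] A) : e 1 = 1 := by
  have h : e 1 * e 1 = e 1 := by rw [← map_mul]; simp
  have hsurj : Function.Surjective e := e.surjective
  have : ∀ y : A, e 1 * y = y := by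
    intro y
    obtain ⟨x, rfl⟩ := hsurj y
    calc e 1 * e x = e (1 * x) := (map_mul e 1 x).symm
    _ = e x := by rw [one_mul]
  have h1 := this 1
  rwa [mul_one] at h1

/-- The unit `ℂ → A` as an equivariant morphism for any action on a unital `A`. -/
def unitGHom {G : Type} [Group G] (A : Type) [CStarAlgebra A] (α : CStarAction G A) :
    GHom G (GCStar.C G) (GCStar.of G A α) where
  hom := unitHomC A
  equivariant g z := by
    have h : (α.app g) (z • (1 : A)) = z • (1 : A) := by
      rw [map_smul, StarAlgEquiv.map_one' (α.app g)]
    exact h.symm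

/-- A unital ⋆-homomorphism as an equivariant morphism for the trivial actions. -/
def toTrivGHom {A B : Type} [CStarAlgebra A] [CStarAlgebra B] (f : A →⋆ₐ[ℂ] B) :
    GHom PUnit (GCStar.of PUnit A (trivialCStarAction PUnit A))
      (GCStar.of PUnit B (trivialCStarAction PUnit B)) where
  hom := f.toNonUnitalStarAlgHom
  equivariant _ _ := rfl

/-- A ⋆-homomorphism as an equivariant morphism for the trivial actions. -/
def trivGHomOfHom {A B : Type} [NonUnitalCStarAlgebra A] [NonUnitalCStarAlgebra B]
    (f : A →⋆ₙₐ[ℂ] B) :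
    GHom PUnit (GCStar.of PUnit A (trivialCStarAction PUnit A))
      (GCStar.of PUnit B (trivialCStarAction PUnit B)) where
  hom := f
  equivariant _ _ := rfl

/-- Matrix-unit data exhibiting `BK` as the stabilization `B ⊗ K(ℓ²(ι))` of `B`:
`θ i j b` plays the role of `b ⊗ e_{i,j}`. -/
structure MatrixUnitsData (ι B BK : Type) [DecidableEq ι] [NonUnitalCStarAlgebra B]
    [NonUnitalCStarAlgebra BK] where
  θ : ι → ι → (B →ₗ[ℂ] BK)
  mul_rel : ∀ (i j k l : ι) (b c : B),
    θ i j b * θ k l c = if j = k then θ i l (b * c) else 0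
  star_rel : ∀ (i j : ι) (b : B), star (θ i j b) = θ j i (star b)
  norm_rel : ∀ (i j : ι) (b : B), ‖θ i j b‖ = ‖b‖
  dense : closure (Submodule.span ℂ (⋃ i : ι, ⋃ j : ι, Set.range (θ i j)) : Set BK) = Set.univ

/-- The corner embedding `B → B ⊗ K` associated to a fixed minimal projection,
built from matrix-unit data. -/
def MatrixUnitsData.cornerHom {ι B BK : Type} [DecidableEq ι] [NonUnitalCStarAlgebra B]
    [NonUnitalCStarAlgebra BK] (d : MatrixUnitsData ι B BK) (i : ι) : B →⋆ₙₐ[ℂ] BK where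
  toFun b := d.θ i i b
  map_smul' z b := by simp
  map_zero' := by simp
  map_add' b c := by simp
  map_mul' b c := by rw [d.mul_rel]; simp
  map_star' b := by rw [d.star_rel]

end
noncomputable section

/-! The standing assumptions of the Pimsner construction (Sec. 4.1 of the paper),
encoded as a structure: `B` unital separable nuclear, `E` separable non-unital
nuclear containing `B ⊗ K` as an essential ideal, a non-degenerate representation
`E ⊆ B(H)` and a compatible unitary representation of `G`, together with the
Toeplitz--Pimsner algebra `T_X` of the G-Hilbert bimodule `X = H ⊗ ℓ²(G) ⊗ E`
(presented by its creation operators `Tcr`), its gauge action and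
the quasi-free `G`-action `Γ`. -/
structure PimsnerSetting (G : Type) [Group G] [DecidableEq G] where
  B : Type
  [instB : CStarAlgebra B]
  sepB : TopologicalSpace.SeparableSpace B
  nucB : IsNuclearCStar B
  BK : Type
  [instBK : NonUnitalCStarAlgebra BK]
  stab : MatrixUnitsData ℕ B BK
  E : Type
  [instE : NonUnitalCStarAlgebra E]
  sepE : TopologicalSpace.SeparableSpace E
  nucE : IsNuclearCStar E
  nonunitalE : ¬ IsUnitalAlgebra E
  approxE : HasIncreasingProjApproxUnit E
  jBK : BK →⋆ₙₐ[ℂ] E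
  jBK_inj : Function.Injective jBK
  ideal_left : ∀ (x : E) (y : BK), x * jBK y ∈ Set.range jBK
  ideal_right : ∀ (x : E) (y : BK), jBK y * x ∈ Set.range jBK
  essential : ∀ x : E, (∀ y : BK, x * jBK y = 0) → x = 0
  H : Type
  [instH : NormedAddCommGroup H]
  [instH2 : InnerProductSpace ℂ H]
  [instH3 : CompleteSpace H]
  rep : E →⋆ₙₐ[ℂ] (H →L[ℂ] H)
  rep_inj : Function.Injective rep
  rep_nondeg : ∀ ζ : H, (∀ x : E, rep x ζ = 0) → ζ = 0
  U : G → (H →L[ℂ] H)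
  U_unitary : ∀ g, U g ∈ unitary (H →L[ℂ] H)
  U_mul : ∀ g h, U (g * h) = U g * U h
  αE : CStarAction G E
  αE_rep : ∀ g x, rep (αE.app g x) = U g * rep x * star (U g)
  αE_BK : ∀ g y, αE.app g (jBK y) ∈ Set.range jBK
  U_fix : ∀ g, U g * rep (jBK (stab.θ 0 0 1)) = rep (jBK (stab.θ 0 0 1))
  fix_U : ∀ g, rep (jBK (stab.θ 0 0 1)) * U g = rep (jBK (stab.θ 0 0 1))
  TX : Type
  [instTX : NonUnitalCStarAlgebra TX]
  ιE : E →⋆ₙₐ[ℂ] TX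
  ιE_inj : Function.Injective ιE
  Tcr : H → G → E → TX
  Tcr_addH : ∀ ζ ξ h x, Tcr (ζ + ξ) h x = Tcr ζ h x + Tcr ξ h x
  Tcr_smulH : ∀ (c : ℂ) ζ h x, Tcr (c • ζ) h x = c • Tcr ζ h x
  Tcr_addE : ∀ ζ h x y, Tcr ζ h (x + y) = Tcr ζ h x + Tcr ζ h y
  Tcr_right : ∀ ζ h x y, Tcr ζ h x * ιE y = Tcr ζ h (x * y)
  Tcr_left : ∀ a ζ h x, ιE a * Tcr ζ h x = Tcr (rep a ζ) h x
  Tcr_star : ∀ ζ h x ξ k y,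
    star (Tcr ζ h x) * Tcr ξ k y = if h = k then (inner ℂ ζ ξ : ℂ) • ιE (star x * y) else 0
  generates : closure ((NonUnitalStarAlgebra.adjoin ℂ
      {t : TX | ∃ ζ h x, t = Tcr ζ h x} : NonUnitalStarSubalgebra ℂ TX) : Set TX) = Set.univ
  vac : TX →ₗ[ℂ] E
  vac_ι : ∀ x, vac (ιE x) = x
  vac_creation : ∀ ζ h x t, vac (Tcr ζ h x * t) = 0
  vac_annihilation : ∀ ζ h x t, vac (t * star (Tcr ζ h x)) = 0
  vac_cr : ∀ ζ h x, vac (Tcr ζ h x) = 0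
  vac_positive : ∀ t, ∃ y, vac (star t * t) = star y * y
  vac_contractive : ∀ t, ‖vac t‖ ≤ ‖t‖
  gauge : CStarAction Circle TX
  gauge_cr : ∀ z ζ h x, gauge.app z (Tcr ζ h x) = (z : ℂ) • Tcr ζ h x
  gauge_ι : ∀ z x, gauge.app z (ιE x) = ιE x
  Γ : CStarAction G TX
  Γ_cr : ∀ g ζ h x, Γ.app g (Tcr ζ h x) = Tcr (U g ζ) (g * h) (αE.app g x)
  Γ_ι : ∀ g x, Γ.app g (ιE x) = ιE (αE.app g x)

attribute [instance] PimsnerSetting.instB PimsnerSetting.instBK PimsnerSetting.instE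
  PimsnerSetting.instH PimsnerSetting.instH2 PimsnerSetting.instH3 PimsnerSetting.instTX

namespace PimsnerSetting

variable {G : Type} [Group G] [DecidableEq G] (S : PimsnerSetting G)

/-- The projection `1_B ⊗ e₀ ∈ B ⊗ K ⊆ E`. -/
def unitProj : S.E := S.jBK (S.stab.θ 0 0 1)

/-- The projection `1_B ⊗ e₀`, viewed in `T_X`. -/
def unitProjT : S.TX := S.ιE S.unitProj

/-- The corner `A_E = (1_B ⊗ e₀) T_X (1_B ⊗ e₀)`. -/
def corner : Set S.TX := {y : S.TX | S.unitProjT * y = y ∧ y * S.unitProjT = y}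

/-- The unital embedding `ι : B → A_E`, `b ↦ b ⊗ e₀`. -/
def cornerEmb : S.B → S.TX := fun b => S.ιE (S.jBK (S.stab.θ 0 0 b))

end PimsnerSetting

/-! The setting of Sec. 3 of the paper: a unital essential extension `K ◁ E`
of `C` by the compacts, non-degenerately represented on `H`, the Toeplitz--Pimsner
algebra `T_X` of `X = H ⊗ ℓ²(ℤ) ⊗ E`, and the shift quasi-free automorphism `Γ`
(given as a `ℤ`-action). -/
structure ToeplitzShiftSetting where
  H : Type
  [instH : NormedAddCommGroup H]
  [instH2 : InnerProductSpace ℂ H]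
  [instH3 : CompleteSpace H]
  E : Type
  [instE : CStarAlgebra E]
  sepE : TopologicalSpace.SeparableSpace E
  rep : E →⋆ₐ[ℂ] (H →L[ℂ] H)
  rep_inj : Function.Injective rep
  compacts_sub : ∀ T : H →L[ℂ] H, IsCompactOperator (⇑T) → T ∈ Set.range rep
  id_not_compact : ¬ IsCompactOperator (⇑(1 : H →L[ℂ] H))
  C : Type
  [instC : CStarAlgebra C]
  sepC : TopologicalSpace.SeparableSpace C
  nucC : IsNuclearCStar C
  quot : E →⋆ₐ[ℂ] C
  quot_surj : Function.Surjective quot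
  quot_ker : ∀ x : E, quot x = 0 ↔ IsCompactOperator (⇑(rep x))
  TX : Type
  [instTX : CStarAlgebra TX]
  ιE : E →⋆ₐ[ℂ] TX
  ιE_inj : Function.Injective ιE
  Tcr : H → ℤ → E → TX
  Tcr_addH : ∀ ζ ξ n x, Tcr (ζ + ξ) n x = Tcr ζ n x + Tcr ξ n x
  Tcr_smulH : ∀ (c : ℂ) ζ n x, Tcr (c • ζ) n x = c • Tcr ζ n x
  Tcr_addE : ∀ ζ n x y, Tcr ζ n (x + y) = Tcr ζ n x + Tcr ζ n y
  Tcr_right : ∀ ζ n x y, Tcr ζ n x * ιE y = Tcr ζ n (x * y)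
  Tcr_left : ∀ a ζ n x, ιE a * Tcr ζ n x = Tcr (rep a ζ) n x
  Tcr_star : ∀ ζ m x ξ n y,
    star (Tcr ζ m x) * Tcr ξ n y = if m = n then (inner ℂ ζ ξ : ℂ) • ιE (star x * y) else 0
  generates : closure ((NonUnitalStarAlgebra.adjoin ℂ
      {t : TX | ∃ ζ n x, t = Tcr ζ n x} : NonUnitalStarSubalgebra ℂ TX) : Set TX) = Set.univ
  vac : TX →ₗ[ℂ] E
  vac_ι : ∀ x, vac (ιE x) = x
  vac_creation : ∀ ζ n x t, vac (Tcr ζ n x * t) = 0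
  vac_annihilation : ∀ ζ n x t, vac (t * star (Tcr ζ n x)) = 0
  vac_cr : ∀ ζ n x, vac (Tcr ζ n x) = 0
  Γ : CStarAction (Multiplicative ℤ) TX
  Γ_cr : ∀ (n : ℤ) ζ m x,
    Γ.app (Multiplicative.ofAdd n) (Tcr ζ m x) = Tcr ζ (n + m) x
  Γ_ι : ∀ (n : ℤ) (x : E), Γ.app (Multiplicative.ofAdd n) (ιE x) = ιE x

attribute [instance] ToeplitzShiftSetting.instH ToeplitzShiftSetting.instH2
  ToeplitzShiftSetting.instH3 ToeplitzShiftSetting.instE ToeplitzShiftSetting.instC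
  ToeplitzShiftSetting.instTX

end
section
open scoped ComplexOrder

theorem pi_isometry {A : Type} [CStarAlgebra A]
    (hPI : ∀ a : A, a ≠ 0 → ∃ x y : A, x * a * y = 1) (a : A) (ha : a ≠ 0) :
    ∃ z : A, star (a * z) * (a * z) = 1 := by
  let _ := CStarAlgebra.spectralOrder A
  let _ := CStarAlgebra.spectralOrderedRing A
  obtain ⟨x, y, h⟩ := hPI a ha
  set m := a * y with hm
  have hxm : x * m = 1 := by rw [hm, ← mul_assoc, h]
  set d := star m * m with hd
  have hd0 : 0 ≤ d := star_mul_self_nonneg m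
  have hle : (1 : A) ≤ (‖star x * x‖ : ℝ) • d := by
    have h1 : star m * (star x * x) * m ≤ star m * (algebraMap ℝ A ‖star x * x‖) * m :=
      star_left_conjugate_le_conjugate (IsSelfAdjoint.le_algebraMap_norm_self (IsSelfAdjoint.star_mul_self x)) m
    have h2 : star m * (star x * x) * m = 1 := by
      calc star m * (star x * x) * m = star (x * m) * (x * m) := by simp [mul_assoc]
        _ = 1 := by rw [hxm]; simp
    rw [h2, Algebra.algebraMap_eq_smul_one] at h1
    simpa [hd] using h1
  have hdu : IsUnit d := by
    rcases subsingleton_or_nontrivial A with hs | hs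
    · exact isUnit_of_subsingleton d
    have h3 : IsUnit ((‖star x * x‖ : ℝ) • d) := CStarAlgebra.isUnit_of_le 1 hle
    have hne : (‖star x * x‖ : ℝ) ≠ 0 := by
      intro h0
      rw [h0, zero_smul] at h3
      exact not_isUnit_zero h3
    exact (isUnit_smul_iff (Units.mk0 _ hne) d).1 h3
  have hsp : ∀ t ∈ spectrum ℝ d, 0 < t := fun t ht =>
    lt_of_le_of_ne (spectrum_nonneg_of_nonneg hd0 ht) (by rintro rfl; exact (spectrum.zero_notMem_iff ℝ).2 hdu ht)
  set e := cfc (fun t : ℝ => (Real.sqrt t)⁻¹) d with he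
  have hc : ContinuousOn (fun t : ℝ => (Real.sqrt t)⁻¹) (spectrum ℝ d) := by
    apply ContinuousOn.inv₀ (by fun_prop)
    intro t ht
    exact (Real.sqrt_pos.2 (hsp t ht)).ne'
  have hesa : star e = e := (cfc_predicate (fun t : ℝ => (Real.sqrt t)⁻¹) d : IsSelfAdjoint _)
  have hdsa : IsSelfAdjoint d := hd0.isSelfAdjoint
  refine ⟨y * e, ?_⟩
  have : star (a * (y * e)) * (a * (y * e)) = e * d * e := by
    rw [← mul_assoc a, ← hm, star_mul, hesa, hd]; simp [mul_assoc]
  rw [this]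
  have hid : d = cfc (fun t : ℝ => t) d := (cfc_id' ℝ d).symm
  have : e * d * e = cfc (fun t : ℝ => (Real.sqrt t)⁻¹ * t * (Real.sqrt t)⁻¹) d := by
    rw [cfc_mul (fun t : ℝ => (Real.sqrt t)⁻¹ * t) (fun t : ℝ => (Real.sqrt t)⁻¹) d (hc.mul continuousOn_id) hc,
      cfc_mul (fun t : ℝ => (Real.sqrt t)⁻¹) (fun t : ℝ => t) d hc continuousOn_id, ← hid]
  rw [this]
  rw [cfc_congr (g := fun _ : ℝ => (1 : ℝ))]
  · exact cfc_const_one ℝ d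
  · intro t ht
    have h0 := hsp t ht
    have h1 := Real.sqrt_pos.2 h0
    simp only
    field_simp
    exact (Real.sq_sqrt h0.le).symm

noncomputable def bumpAt (l η : ℝ) (t : ℝ) : ℝ := max 0 (η - |t - l|)
theorem bumpAt_cont (l η : ℝ) : Continuous (bumpAt l η) := by unfold bumpAt; fun_prop

theorem pi_eig {A : Type} [CStarAlgebra A] 
    (hPI : ∀ a : A, a ≠ 0 → ∃ x y : A, x * a * y = 1) (b : A) (hb : IsSelfAdjoint b)
    (l : ℝ) (hl : l ∈ spectrum ℝ b) (η : ℝ) (hη : 0 < η) :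
    ∃ s z : A, s = cfc (bumpAt l η) b * z ∧ star s * s = 1 ∧ ‖b * s - l • s‖ ≤ η := by
  have hcont := bumpAt_cont l η
  have hne : cfc (bumpAt l η) b ≠ 0 := by
    intro h0
    have h1 : bumpAt l η l ∈ spectrum ℝ (cfc (bumpAt l η) b) := by
      rw [cfc_map_spectrum (bumpAt l η) b]
      exact ⟨l, hl, rfl⟩
    have hnt : Nontrivial A := by
      by_contra hn
      rw [not_nontrivial_iff_subsingleton] at hn
      simp [spectrum.of_subsingleton] at hl
    rw [h0, spectrum.zero_eq] at h1
    have : bumpAt l η l = η := by simp [bumpAt, hη.le]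
    rw [this] at h1
    exact hη.ne' h1
  obtain ⟨z, hz⟩ := pi_isometry hPI _ hne
  refine ⟨_, z, rfl, hz, ?_⟩
  set s := cfc (bumpAt l η) b * z with hs
  let k : ℝ → ℝ := fun t => max (-η) (min η (t - l))
  have hk : Continuous k := by fun_prop
  have key : b * cfc (bumpAt l η) b - l • cfc (bumpAt l η) b = cfc k b * cfc (bumpAt l η) b := by
    have hid : b = cfc (fun t : ℝ => t) b := (cfc_id' ℝ b).symm
    conv_lhs => enter [1,1]; rw [hid]
    rw [← cfc_mul _ _ b, ← cfc_smul l _ b, ← cfc_sub _ _ b, ← cfc_mul _ _ b]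
    apply cfc_congr
    intro t _
    simp only [bumpAt, k, smul_eq_mul]
    rcases le_or_gt (η - |t - l|) 0 with h | h
    · rw [max_eq_left h]; ring
    · have h2 : |t - l| < η := by linarith
      rw [abs_lt] at h2
      rw [min_eq_right h2.2.le, max_eq_right h2.1.le]; ring
  have : b * s - l • s = cfc k b * s := by
    rw [hs, ← mul_assoc, ← mul_assoc, ← key, sub_mul, smul_mul_assoc]
  rw [this]
  have h1 : ‖cfc k b‖ ≤ η := by
    apply norm_cfc_le hη.le
    intro t _
    rw [Real.norm_eq_abs, abs_le]
    exact ⟨le_max_left _ _, max_le (by linarith) (min_le_left _ _)⟩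
  have h2 : ‖s‖ ≤ 1 := by
    have : ‖s‖ * ‖s‖ ≤ 1 := by rw [← CStarRing.norm_star_mul_self, hz]; 
                               rcases subsingleton_or_nontrivial A with h | h
                               · simp [Subsingleton.elim (1:A) 0]
                               · simp
    nlinarith [norm_nonneg s]
  calc ‖cfc k b * s‖ ≤ ‖cfc k b‖ * ‖s‖ := norm_mul_le _ _
    _ ≤ η * 1 := by gcongr
    _ = η := mul_one _

theorem bump_mul {A : Type} [CStarAlgebra A] (b : A) (l l' η : ℝ) (h : 2 * η ≤ |l - l'|) :
    cfc (bumpAt l η) b * cfc (bumpAt l' η) b = 0 := by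
  have h1 := bumpAt_cont l η
  have h2 := bumpAt_cont l' η
  rw [← cfc_mul _ _ b]
  rw [cfc_congr (g := fun _ : ℝ => (0 : ℝ)), cfc_const_zero]
  intro t _
  simp only [bumpAt]
  rcases le_or_gt (η - |t - l|) 0 with h | h
  · rw [max_eq_left h]; ring
  · rw [max_eq_left (a := (0:ℝ)) (b := η - |t - l'|)]; ring
    have := abs_sub_le l t l'
    rw [abs_sub_comm l t] at this
    linarith


theorem iso_norm_le {A : Type} [CStarAlgebra A] {s : A} (hs : star s * s = 1) : ‖s‖ ≤ 1 := by
  have : ‖s‖ * ‖s‖ ≤ 1 := by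
    rw [← CStarRing.norm_star_mul_self, hs]
    rcases subsingleton_or_nontrivial A with h | h
    · simp [Subsingleton.elim (1:A) 0]
    · simp
  nlinarith [norm_nonneg s]

theorem iso_mul {A : Type} [CStarAlgebra A] {s t : A} (hs : star s * s = 1) (ht : star t * t = 1) :
    star (s * t) * (s * t) = 1 := by
  calc star (s * t) * (s * t) = star t * (star s * s) * t := by simp [mul_assoc]
    _ = 1 := by rw [hs, mul_one, ht]

theorem iso_map {A : Type} [CStarAlgebra A] (α : A ≃⋆ₐ[ℂ] A) {s : A} (hs : star s * s = 1) :
    star (α s) * (α s) = 1 := by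
  rw [← map_star, ← map_mul, hs, map_one]

theorem norm_mul_iso_le {A : Type} [CStarAlgebra A] {s : A} (c : A) (hs : star s * s = 1) :
    ‖c * s‖ ≤ ‖c‖ := by
  calc ‖c * s‖ ≤ ‖c‖ * ‖s‖ := norm_mul_le _ _
    _ ≤ ‖c‖ * 1 := by gcongr; exact iso_norm_le hs
    _ = _ := mul_one _

theorem norm_star_iso_mul_le {A : Type} [CStarAlgebra A] {s : A} (c : A) (hs : star s * s = 1) :
    ‖star s * c‖ ≤ ‖c‖ := by
  calc ‖star s * c‖ ≤ ‖star s‖ * ‖c‖ := norm_mul_le _ _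
    _ ≤ 1 * ‖c‖ := by gcongr; rw [norm_star]; exact iso_norm_le hs
    _ = _ := one_mul _

theorem norm_iso_mul {A : Type} [CStarAlgebra A] {s : A} (c : A) (hs : star s * s = 1) :
    ‖s * c‖ = ‖c‖ := by
  apply le_antisymm
  · calc ‖s * c‖ ≤ ‖s‖ * ‖c‖ := norm_mul_le _ _
      _ ≤ 1 * ‖c‖ := by gcongr; exact iso_norm_le hs
      _ = _ := one_mul _
  · calc ‖c‖ = ‖star s * (s * c)‖ := by rw [← mul_assoc, hs, one_mul]
      _ ≤ ‖s * c‖ := norm_star_iso_mul_le _ hs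

/-- lower bound on the spectrum from all isometries -/
theorem low0 {A : Type} [CStarAlgebra A] [PartialOrder A] [StarOrderedRing A]
    (hPI : ∀ a : A, a ≠ 0 → ∃ x y : A, x * a * y = 1) (c : A) (κ : ℝ) (hκ : 0 ≤ κ)
    (h : ∀ r : A, star r * r = 1 → κ ≤ ‖c * r‖) : algebraMap ℝ A (κ ^ 2) ≤ star c * c := by
  rw [algebraMap_le_iff_le_spectrum (R := ℝ) (a := star c * c) (ha := IsSelfAdjoint.star_mul_self c)]
  intro μ hμ
  apply le_of_forall_pos_le_add
  intro η hη
  obtain ⟨s, z, -, hs, hn⟩ := pi_eig hPI _ (IsSelfAdjoint.star_mul_self c) μ hμ η hη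
  have hμ0 : 0 ≤ μ := spectrum_nonneg_of_nonneg (star_mul_self_nonneg c) hμ
  have h1 := h s hs
  have h2 : ‖c * s‖ * ‖c * s‖ ≤ μ + η := by
    rw [← CStarRing.norm_star_mul_self]
    have e : star (c * s) * (c * s) = star s * (star c * c * s - μ • s) + star s * (μ • s) := by
      simp [mul_sub, mul_assoc]
    rw [e]
    calc _ ≤ ‖star s * (star c * c * s - μ • s)‖ + ‖star s * (μ • s)‖ := norm_add_le _ _
      _ ≤ η + μ := by
        gcongr
        · exact (norm_star_iso_mul_le _ hs).trans hn
        · refine (norm_star_iso_mul_le _ hs).trans ?_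
          rw [norm_smul, Real.norm_of_nonneg hμ0]
          nlinarith [iso_norm_le hs]
      _ = _ := add_comm _ _
  nlinarith

theorem offdiag {A : Type} [CStarAlgebra A] [Nontrivial A] [PartialOrder A] [StarOrderedRing A]
    (s t m : A) (hs : star s * s = 1) (ht : star t * t = 1) (hst : star s * t = 0) (κ τ : ℝ)
    (hτ : 0 ≤ τ)
    (h1 : algebraMap ℝ A (κ ^ 2) ≤ star (star s * m) * (star s * m))
    (h2 : ‖m‖ ^ 2 ≤ κ ^ 2 + τ ^ 2) : ‖star t * m‖ ≤ τ := by
  have hts : star t * s = 0 := by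
    have := congrArg star hst
    simpa using this
  set p := 1 - s * star s - t * star t with hp
  have hpp : star p * p = p := by
    have e1 : s * star s * (s * star s) = s * star s := by
      rw [mul_assoc, ← mul_assoc (star s), hs, one_mul]
    have e2 : t * star t * (t * star t) = t * star t := by
      rw [mul_assoc, ← mul_assoc (star t), ht, one_mul]
    have e3 : s * star s * (t * star t) = 0 := by
      rw [mul_assoc, ← mul_assoc (star s), hst]; simp
    have e4 : t * star t * (s * star s) = 0 := by
      rw [mul_assoc, ← mul_assoc (star t), hts]; simp
    have : star p = p := by simp [hp]
    rw [this, hp]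
    simp only [sub_mul, mul_sub, e1, e2, e3, e4, one_mul, mul_one]
    abel
  have h3 : star (star t * m) * (star t * m) = star m * m - star (star s * m) * (star s * m) - star (p * m) * (p * m) := by
    have : star (p * m) * (p * m) = star m * (star p * p) * m := by simp [mul_assoc]
    rw [this, hpp, hp]
    simp only [star_mul, star_star]
    noncomm_ring
  have h4 : star (star t * m) * (star t * m) ≤ algebraMap ℝ A (τ ^ 2) := by
    rw [h3]
    have h5 : star m * m ≤ algebraMap ℝ A (κ ^ 2 + τ ^ 2) := by
      refine (IsSelfAdjoint.le_algebraMap_norm_self (IsSelfAdjoint.star_mul_self m)).trans ?_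
      rw [algebraMap_le_algebraMap, CStarRing.norm_star_mul_self]
      nlinarith
    rw [map_add] at h5
    have h6 : 0 ≤ star (p * m) * (p * m) := star_mul_self_nonneg _
    calc _ ≤ star m * m - star (star s * m) * (star s * m) := sub_le_self _ h6
      _ ≤ (algebraMap ℝ A (κ ^ 2) + algebraMap ℝ A (τ ^ 2)) - algebraMap ℝ A (κ ^ 2) := sub_le_sub h5 h1
      _ = _ := by abel
  have h7 := CStarAlgebra.norm_le_norm_of_nonneg_of_le (star_mul_self_nonneg _) h4
  rw [CStarRing.norm_star_mul_self] at h7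
  have h8 : ‖algebraMap ℝ A (τ ^ 2)‖ ≤ τ ^ 2 := by
    rcases subsingleton_or_nontrivial A with h | h
    · rw [Subsingleton.elim (algebraMap ℝ A (τ ^ 2)) 0]; simp; positivity
    · rw [norm_algebraMap']; simp
  nlinarith [norm_nonneg (star t * m)]

theorem parallel {A : Type} [CStarAlgebra A] [Nontrivial A] [PartialOrder A] [StarOrderedRing A]
    (P Q E X : A) (hX : X = P + Q + E) (κ τ M : ℝ) (hM : 0 ≤ M) (hτ : 0 ≤ τ)
    (hP : ‖P‖ ≤ M) (hQ : ‖Q‖ ≤ M) (hE : ‖E‖ ≤ 2 * τ) (hXn : ‖X‖ ≤ 2 * M)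
    (hXl : algebraMap ℝ A (4 * κ ^ 2) ≤ star X * X) (hMκ : M ^ 2 ≤ κ ^ 2 + τ ^ 2) :
    ‖P - Q‖ ^ 2 ≤ 4 * τ ^ 2 + 8 * M * τ := by
  have key : star (P - Q) * (P - Q) = (2:ℝ) • (star P * P) + (2:ℝ) • (star Q * Q) - star X * X
      + (star X * E + star E * X) - star E * E := by
    have : P + Q = X - E := by rw [hX]; abel
    have h2 : star (P + Q) * (P + Q) = star X * X - (star X * E + star E * X) + star E * E := by
      rw [this]; simp only [star_sub]; noncomm_ring
    have h3 : star (P - Q) * (P - Q) = (2:ℝ) • (star P * P) + (2:ℝ) • (star Q * Q) - star (P + Q) * (P + Q) := by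
      simp only [star_sub, star_add, two_smul]; noncomm_ring
    rw [h3, h2]; abel
  have b1 : ∀ y : A, ‖y‖ ≤ M → (2:ℝ) • (star y * y) ≤ algebraMap ℝ A (2 * M ^ 2) := by
    intro y hy
    rw [map_mul, Algebra.algebraMap_eq_smul_one (2:ℝ), smul_mul_assoc, one_mul]
    refine smul_le_smul_of_nonneg_left ?_ (by norm_num)
    refine (IsSelfAdjoint.le_algebraMap_norm_self (IsSelfAdjoint.star_mul_self y)).trans ?_
    rw [algebraMap_le_algebraMap, CStarRing.norm_star_mul_self]
    nlinarith [norm_nonneg y]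
  have b2 : star X * E + star E * X ≤ algebraMap ℝ A (8 * M * τ) := by
    have sa : IsSelfAdjoint (star X * E + star E * X) := by
      simp [IsSelfAdjoint, add_comm]
    refine (IsSelfAdjoint.le_algebraMap_norm_self sa).trans ?_
    rw [algebraMap_le_algebraMap]
    calc _ ≤ ‖star X‖ * ‖E‖ + ‖star E‖ * ‖X‖ := (norm_add_le _ _).trans (add_le_add (norm_mul_le _ _) (norm_mul_le _ _))
      _ ≤ (2 * M) * (2 * τ) + (2 * τ) * (2 * M) := by rw [norm_star, norm_star]; gcongr
      _ = _ := by ring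
  have h4 : star (P - Q) * (P - Q) ≤ algebraMap ℝ A (4 * τ ^ 2 + 8 * M * τ) := by
    rw [key]
    calc _ ≤ (2:ℝ) • (star P * P) + (2:ℝ) • (star Q * Q) - star X * X
      + (star X * E + star E * X) := sub_le_self _ (star_mul_self_nonneg _)
      _ ≤ algebraMap ℝ A (2 * M ^ 2) + algebraMap ℝ A (2 * M ^ 2) - algebraMap ℝ A (4 * κ ^ 2) + algebraMap ℝ A (8 * M * τ) :=
        add_le_add (sub_le_sub (add_le_add (b1 P hP) (b1 Q hQ)) hXl) b2
      _ = algebraMap ℝ A (2 * M ^ 2 + 2 * M ^ 2 - 4 * κ ^ 2 + 8 * M * τ) := by simp only [map_add, map_sub]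
      _ ≤ _ := by rw [algebraMap_le_algebraMap]; nlinarith
  have h7 := CStarAlgebra.norm_le_norm_of_nonneg_of_le (star_mul_self_nonneg _) h4
  rw [CStarRing.norm_star_mul_self] at h7
  have hpos : 0 ≤ 4 * τ ^ 2 + 8 * M * τ := by positivity
  have h8 : ‖algebraMap ℝ A (4 * τ ^ 2 + 8 * M * τ)‖ ≤ 4 * τ ^ 2 + 8 * M * τ := by
    rcases subsingleton_or_nontrivial A with h | h
    · rw [Subsingleton.elim (algebraMap ℝ A (4 * τ ^ 2 + 8 * M * τ)) 0]; simpa using hpos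
    · rw [norm_algebraMap', Real.norm_of_nonneg hpos]
  nlinarith [norm_nonneg (P - Q)]

/-- improvement step -/
theorem kish_step {A : Type} [CStarAlgebra A] [Nontrivial A]
    (hPI : ∀ a : A, a ≠ 0 → ∃ x y : A, x * a * y = 1)
    (s t : A) (hs : star s * s = 1) (ht : star t * t = 1) (hst : star s * t = 0)
    (α : A ≃⋆ₐ[ℂ] A) (c : A) (η : ℝ) (hη : 0 < η) :
    ∃ r : A, star r * r = 1 ∧ ∀ ρ : A, star ρ * ρ = 1 →
      ‖star ρ * (star r * c * α r) * α ρ - star r * c * α r‖ ≤ η := by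
  let _ := CStarAlgebra.spectralOrder A
  let _ := CStarAlgebra.spectralOrderedRing A
  have hts : star t * s = 0 := by
    have := congrArg star hst
    simpa using this
  let S : Set ℝ := {x | ∃ r : A, star r * r = 1 ∧ x = ‖star r * c * α r‖}
  have hSne : S.Nonempty := ⟨_, 1, by simp, rfl⟩
  have hSb : BddBelow S := ⟨0, by rintro x ⟨r, -, rfl⟩; exact norm_nonneg _⟩
  set κ := sInf S with hκ
  have hκ0 : 0 ≤ κ := le_csInf hSne (by rintro x ⟨r, -, rfl⟩; exact norm_nonneg _)
  obtain ⟨τ, hτ0, hτ⟩ : ∃ τ : ℝ, 0 < τ ∧ 4 * τ ^ 2 + 8 * ‖c‖ * τ ≤ (η / 2) ^ 2 := by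
    refine ⟨min 1 ((η / 2) ^ 2 / (4 + 8 * ‖c‖)), by positivity, ?_⟩
    set τ := min 1 ((η / 2) ^ 2 / (4 + 8 * ‖c‖))
    have h1 : τ ≤ 1 := min_le_left _ _
    have h0 : 0 < τ := by positivity
    have h2 : τ * (4 + 8 * ‖c‖) ≤ (η / 2) ^ 2 := by
      rw [← le_div_iff₀ (by positivity)]; exact min_le_right _ _
    nlinarith
  have hlt : κ < Real.sqrt (κ ^ 2 + τ ^ 2) := by
    apply Real.lt_sqrt_of_sq_lt; nlinarith
  obtain ⟨x, ⟨r0, hr0, rfl⟩, hr0n⟩ := exists_lt_of_csInf_lt hSne hlt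
  set c1 := star r0 * c * α r0 with hc1
  have hgood : ∀ r : A, star r * r = 1 → κ ≤ ‖star r * c1 * α r‖ := by
    intro r hr
    apply csInf_le hSb
    refine ⟨r0 * r, iso_mul hr0 hr, ?_⟩
    simp [hc1, mul_assoc]
  have hc1n : ‖c1‖ ^ 2 ≤ κ ^ 2 + τ ^ 2 := by
    have h1 : Real.sqrt (κ ^ 2 + τ ^ 2) ^ 2 = κ ^ 2 + τ ^ 2 := Real.sq_sqrt (by positivity)
    have h2 : ‖c1‖ ^ 2 ≤ Real.sqrt (κ ^ 2 + τ ^ 2) ^ 2 := by gcongr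
    linarith
  have hc1c : ‖c1‖ ≤ ‖c‖ := (norm_mul_iso_le _ (iso_map α hr0)).trans (norm_star_iso_mul_le _ hr0)
  -- lower bounds
  have hlow : ∀ r : A, star r * r = 1 →
      algebraMap ℝ A (κ ^ 2) ≤ star (star r * c1 * α r) * (star r * c1 * α r) := by
    intro r hr
    apply low0 hPI _ _ hκ0
    intro ρ hρ
    have h1 : α.symm ρ = α.symm ρ := rfl
    have h2 : star (α.symm ρ) * α.symm ρ = 1 := iso_map α.symm hρ
    have h3 := hgood (r * α.symm ρ) (iso_mul hr h2)
    refine h3.trans ?_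
    have : star (r * α.symm ρ) * c1 * α (r * α.symm ρ) = star (α.symm ρ) * (star r * c1 * α r * ρ) := by
      simp [mul_assoc]
    rw [this]
    exact norm_star_iso_mul_le _ h2
  have hoff1 : ‖star t * (c1 * α s)‖ ≤ τ := by
    apply offdiag s t _ hs ht hst κ τ hτ0.le
    · have := hlow s hs
      simpa only [mul_assoc] using this
    · refine le_trans ?_ hc1n
      gcongr
      exact norm_mul_iso_le _ (iso_map α hs)
  have hoff2 : ‖star s * (c1 * α t)‖ ≤ τ := by
    apply offdiag t s _ ht hs hts κ τ hτ0.le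
    · have := hlow t ht
      simpa only [mul_assoc] using this
    · refine le_trans ?_ hc1n
      gcongr
      exact norm_mul_iso_le _ (iso_map α ht)
  have main : ∀ ρ : A, star ρ * ρ = 1 →
      ‖star s * c1 * α s - star (t * ρ) * c1 * α (t * ρ)‖ ≤ η / 2 := by
    intro ρ hρ
    have htρ := iso_mul ht hρ
    set R := s + t * ρ with hR
    have hRR : star R * R = (2:ℝ) • (1:A) := by
      have e1 : star s * (t * ρ) = 0 := by rw [← mul_assoc, hst, zero_mul]
      have e2 : star (t * ρ) * s = 0 := by rw [star_mul, mul_assoc, hts, mul_zero]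
      rw [hR, star_add, add_mul, mul_add, mul_add, hs, htρ, e1, e2, two_smul]; simp
    have hlowX : algebraMap ℝ A (4 * κ ^ 2) ≤ star (star R * c1 * α R) * (star R * c1 * α R) := by
      set w : ℝ := (Real.sqrt 2)⁻¹ with hw
      have hw2 : w * w = 1 / 2 := by
        rw [hw, ← mul_inv, Real.mul_self_sqrt (by norm_num)]; norm_num
      have hiso : star ((w:ℂ) • R) * ((w:ℂ) • R) = 1 := by
        rw [star_smul, smul_mul_smul_comm, hRR]
        have : star (w:ℂ) * (w:ℂ) = ((1/2 : ℝ) : ℂ) := by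
          rw [← hw2]; simp
        rw [this, Complex.coe_smul, smul_smul]; norm_num
      have h1 := hlow _ hiso
      have e : star ((w:ℂ) • R) * c1 * α ((w:ℂ) • R) = ((1/2 : ℝ)) • (star R * c1 * α R) := by
        rw [map_smul, star_smul, smul_mul_assoc, smul_mul_smul_comm]
        have : star (w:ℂ) * (w:ℂ) = ((1/2 : ℝ) : ℂ) := by
          rw [← hw2]; simp
        rw [this, Complex.coe_smul]
      rw [e, star_smul, smul_mul_smul_comm] at h1
      have h2 := smul_le_smul_of_nonneg_left h1 (show (0:ℝ) ≤ 4 by norm_num)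
      have e3 : (4:ℝ) • algebraMap ℝ A (κ ^ 2) = algebraMap ℝ A (4 * κ ^ 2) := by
        rw [map_mul, Algebra.smul_def]
      rw [e3, smul_smul] at h2
      convert h2 using 1
      norm_num
    have hsq := parallel (star s * c1 * α s) (star (t * ρ) * c1 * α (t * ρ))
      (star s * c1 * α (t * ρ) + star (t * ρ) * c1 * α s) (star R * c1 * α R)
      (by rw [hR, star_add, map_add]; simp only [add_mul, mul_add]; abel) κ τ ‖c1‖ (norm_nonneg _) hτ0.le
      ((norm_mul_iso_le _ (iso_map α hs)).trans (norm_star_iso_mul_le _ hs))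
      ((norm_mul_iso_le _ (iso_map α htρ)).trans (norm_star_iso_mul_le _ htρ))
      (by
        have e1 : ‖star s * c1 * α (t * ρ)‖ ≤ τ := by
          have : star s * c1 * α (t * ρ) = star s * (c1 * α t) * α ρ := by simp [mul_assoc]
          rw [this]
          exact (norm_mul_iso_le _ (iso_map α hρ)).trans hoff2
        have e2 : ‖star (t * ρ) * c1 * α s‖ ≤ τ := by
          have : star (t * ρ) * c1 * α s = star ρ * (star t * (c1 * α s)) := by simp [mul_assoc]
          rw [this]
          exact (norm_star_iso_mul_le _ hρ).trans hoff1
        linarith [norm_add_le (star s * c1 * α (t * ρ)) (star (t * ρ) * c1 * α s)])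
      (by
        have hRn : ‖R‖ * ‖R‖ ≤ 2 := by
          rw [← CStarRing.norm_star_mul_self, hRR, norm_smul]
          have := iso_norm_le (s := (1:A)) (by simp)
          norm_num
        have hRn' : ‖α R‖ = ‖R‖ := NonUnitalStarAlgHom.norm_map α α.injective R
        calc ‖star R * c1 * α R‖ ≤ ‖star R * c1‖ * ‖α R‖ := norm_mul_le _ _
          _ ≤ ‖star R‖ * ‖c1‖ * ‖α R‖ := by gcongr; exact norm_mul_le _ _
          _ = (‖R‖ * ‖R‖) * ‖c1‖ := by rw [norm_star, hRn']; ring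
          _ ≤ 2 * ‖c1‖ := by gcongr)
      hlowX hc1n
    have : ‖star s * c1 * α s - star (t * ρ) * c1 * α (t * ρ)‖ ^ 2 ≤ (η / 2) ^ 2 := by
      refine hsq.trans (le_trans ?_ hτ)
      gcongr
    exact (pow_le_pow_iff_left₀ (norm_nonneg _) (by positivity) (by norm_num)).1 this
  refine ⟨r0 * t, iso_mul hr0 ht, ?_⟩
  intro ρ hρ
  have e1 : star ρ * (star (r0 * t) * c * α (r0 * t)) * α ρ = star (t * ρ) * c1 * α (t * ρ) := by
    simp [hc1, mul_assoc]
  have e2 : star (r0 * t) * c * α (r0 * t) = star (t * 1) * c1 * α (t * 1) := by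
    simp [hc1, mul_assoc]
  rw [e1, e2]
  have m1 := main ρ hρ
  have m2 := main 1 (by simp)
  calc _ = ‖(star s * c1 * α s - star (t * 1) * c1 * α (t * 1)) - (star s * c1 * α s - star (t * ρ) * c1 * α (t * ρ))‖ := by
        congr 1; abel
    _ ≤ η / 2 + η / 2 := (norm_sub_le _ _).trans (add_le_add m2 m1)
    _ = η := by ring


/-- Kishimoto type lemma: for an automorphism which is not inner, one finds isometries with
`r* a α(r)` small. -/
theorem kish {A : Type} [CStarAlgebra A] [Nontrivial A]
    (hPI : ∀ a : A, a ≠ 0 → ∃ x y : A, x * a * y = 1)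
    (s t : A) (hs : star s * s = 1) (ht : star t * t = 1) (hst : star s * t = 0)
    (α : A ≃⋆ₐ[ℂ] A)
    (hα : ¬ ∃ u : A, u ∈ unitary A ∧ ∀ a : A, α a = u * a * star u)
    (a : A) (ε : ℝ) (hε : 0 < ε) :
    ∃ r : A, star r * r = 1 ∧ ‖star r * a * α r‖ < ε := by
  by_contra hcon
  push Not at hcon
  apply hα
  choose f hf1 hf2 using fun (c : A) (n : ℕ) =>
    kish_step hPI s t hs ht hst α c ((1 / 2 : ℝ) ^ n) (by positivity)
  let C : ℕ → A := fun n => Nat.rec a (fun n c => star (f c n) * c * α (f c n)) n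
  have hC : ∀ n, C (n + 1) = star (f (C n) n) * C n * α (f (C n) n) := fun n => rfl
  have hlow : ∀ n, ∀ r : A, star r * r = 1 → ε ≤ ‖star r * C n * α r‖ := by
    intro n
    induction n with
    | zero => exact hcon
    | succ n ih =>
      intro r hr
      have := ih (f (C n) n * r) (iso_mul (hf1 _ _) hr)
      rw [hC]
      simpa [mul_assoc] using this
  have hstep : ∀ n, ∀ r : A, star r * r = 1 → ‖star r * C (n + 1) * α r - C (n + 1)‖ ≤ (1 / 2 : ℝ) ^ n := by
    intro n r hr
    have := hf2 (C n) n r hr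
    rw [hC]
    exact this
  have hdist : ∀ n, dist (C (n + 1)) (C (n + 2)) ≤ 1 * (1 / 2 : ℝ) ^ n := by
    intro n
    rw [dist_comm, dist_eq_norm, one_mul]
    exact hstep n _ (hf1 _ _)
  have hcau : CauchySeq (fun n => C (n + 1)) :=
    cauchySeq_of_le_geometric (1 / 2) 1 (by norm_num) hdist
  obtain ⟨b, hb⟩ := cauchySeq_tendsto_of_complete hcau
  have hfix : ∀ r : A, star r * r = 1 → star r * b * α r = b := by
    intro r hr
    have h1 : Filter.Tendsto (fun n => ‖star r * C (n + 1) * α r - C (n + 1)‖) Filter.atTop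
        (nhds ‖star r * b * α r - b‖) :=
      (((hb.const_mul (star r)).mul_const (α r)).sub hb).norm
    have h2 : Filter.Tendsto (fun n : ℕ => (1 / 2 : ℝ) ^ n) Filter.atTop (nhds 0) :=
      tendsto_pow_atTop_nhds_zero_of_lt_one (by norm_num) (by norm_num)
    have h3 := le_of_tendsto_of_tendsto' h1 h2 (fun n => hstep n r hr)
    exact sub_eq_zero.1 (norm_le_zero_iff.1 h3)
  have hbn : ε ≤ ‖b‖ := by
    refine ge_of_tendsto' hb.norm (fun n => ?_)
    simpa using hlow (n + 1) 1 (by simp)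
  let _ := CStarAlgebra.spectralOrder A
  let _ := CStarAlgebra.spectralOrderedRing A
  have hup : ∀ c : A, ‖c‖ = ‖b‖ → star c * c ≤ algebraMap ℝ A (‖b‖ ^ 2) := by
    intro c hc
    refine (IsSelfAdjoint.le_algebraMap_norm_self (IsSelfAdjoint.star_mul_self c)).trans ?_
    rw [algebraMap_le_algebraMap, CStarRing.norm_star_mul_self, hc]
    nlinarith
  have hb1 : star b * b = algebraMap ℝ A (‖b‖ ^ 2) := by
    apply le_antisymm (hup b rfl)
    apply low0 hPI _ _ (norm_nonneg _)
    intro ρ hρ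
    have h2 : star (α.symm ρ) * α.symm ρ = 1 := iso_map α.symm hρ
    have h3 := hfix _ h2
    rw [mul_assoc, StarAlgEquiv.apply_symm_apply] at h3
    conv_lhs => rw [← h3]
    exact norm_star_iso_mul_le _ h2
  have hb2 : b * star b = algebraMap ℝ A (‖b‖ ^ 2) := by
    have : star (star b) * star b = algebraMap ℝ A (‖b‖ ^ 2) := by
      apply le_antisymm (hup (star b) (norm_star b))
      apply low0 hPI _ _ (norm_nonneg _)
      intro ρ hρ
      have h3 := hfix _ hρ
      conv_lhs => rw [← h3]
      refine (norm_mul_iso_le _ (iso_map α hρ)).trans ?_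
      rw [← norm_star]; simp
    rwa [star_star] at this
  have hbpos : 0 < ‖b‖ := lt_of_lt_of_le hε hbn
  have hcomm : ∀ x : A, b * α x = x * b := by
    intro x
    have hx : x ∈ Submodule.span ℂ (unitary A : Set A) := by
      rw [CStarAlgebra.span_unitary]; trivial
    induction hx using Submodule.span_induction with
    | mem u hu =>
      have h1 := hfix u (Unitary.star_mul_self_of_mem hu)
      calc b * α u = u * star u * (b * α u) := by rw [Unitary.mul_star_self_of_mem hu, one_mul]
        _ = u * (star u * b * α u) := by simp only [mul_assoc]
        _ = u * b := by rw [h1]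
    | zero => simp
    | add x y _ _ hx hy => rw [map_add, mul_add, hx, hy, add_mul]
    | smul c x _ hx => rw [map_smul, mul_smul_comm, hx, smul_mul_assoc]
  have hk : ∀ y : A, y = algebraMap ℝ A (‖b‖ ^ 2) → (‖b‖⁻¹ : ℝ) • (‖b‖⁻¹ : ℝ) • y = 1 := by
    rintro y rfl
    rw [smul_smul, Algebra.algebraMap_eq_smul_one, smul_smul]
    have : ‖b‖⁻¹ * ‖b‖⁻¹ * ‖b‖ ^ 2 = 1 := by field_simp
    rw [this, one_smul]
  refine ⟨(‖b‖⁻¹ : ℝ) • star b, ?_, ?_⟩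
  · rw [Unitary.mem_iff]
    constructor
    · simp only [star_smul, star_star, smul_mul_assoc, mul_smul_comm, star_trivial]
      exact hk _ hb2
    · simp only [star_smul, star_star, smul_mul_assoc, mul_smul_comm, star_trivial]
      exact hk _ hb1
  · intro x
    simp only [star_smul, star_star, smul_mul_assoc, mul_smul_comm, star_trivial]
    rw [mul_assoc, ← hcomm, ← mul_assoc, ← smul_mul_assoc, ← smul_mul_assoc, hk _ hb1, one_mul]

/-- finite family version -/
theorem kish_list {A : Type} [CStarAlgebra A] [Nontrivial A]
    (hPI : ∀ a : A, a ≠ 0 → ∃ x y : A, x * a * y = 1)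
    (s t : A) (hs : star s * s = 1) (ht : star t * t = 1) (hst : star s * t = 0)
    {ι : Type} (α : ι → A ≃⋆ₐ[ℂ] A)
    (a : ι → A) (ε : ℝ) (hε : 0 < ε) (S : Finset ι)
    (hα : ∀ i ∈ S, ¬ ∃ u : A, u ∈ unitary A ∧ ∀ a : A, α i a = u * a * star u) :
    ∃ r : A, star r * r = 1 ∧ ∀ i ∈ S, ‖star r * a i * α i r‖ < ε := by
  classical
  induction S using Finset.induction_on with
  | empty => exact ⟨1, by simp, by simp⟩
  | insert i S hi ih =>
    obtain ⟨r, hr, h⟩ := ih (fun j hj => hα j (Finset.mem_insert_of_mem hj))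
    obtain ⟨ρ, hρ, h'⟩ := kish hPI s t hs ht hst (α i) (hα i (Finset.mem_insert_self _ _))
      (star r * a i * α i r) ε hε
    refine ⟨r * ρ, iso_mul hr hρ, ?_⟩
    intro j hj
    rcases Finset.mem_insert.1 hj with rfl | hj
    · simpa [mul_assoc] using h'
    · refine lt_of_le_of_lt ?_ (h j hj)
      have : star (r * ρ) * a j * α j (r * ρ) = star ρ * (star r * a j * α j r) * α j ρ := by
        simp [mul_assoc]
      rw [this]
      exact (norm_mul_iso_le _ (iso_map _ hρ)).trans (norm_star_iso_mul_le _ hρ)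


noncomputable def cay {A : Type} [CStarAlgebra A] (H : A) : A :=
  (2:ℂ) • Ring.inverse (1 - Complex.I • H) - 1

theorem cay_isUnit {A : Type} [CStarAlgebra A] {H : A} (hH : IsSelfAdjoint H) :
    IsUnit (1 - Complex.I • H) := by
  have h1 : (-Complex.I) ∉ spectrum ℂ H := by
    intro h
    have := hH.mem_spectrum_eq_re h
    have h2 := congrArg Complex.im this
    simp at h2
  rw [spectrum.notMem_iff] at h1
  have h3 : 1 - Complex.I • H = Complex.I • (algebraMap ℂ A (-Complex.I) - H) := by
    rw [smul_sub, Algebra.algebraMap_eq_smul_one, smul_smul]; simp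
  rw [h3]
  exact (isUnit_smul_iff (Units.mk0 Complex.I Complex.I_ne_zero) _).2 h1

theorem cay_mul {A : Type} [CStarAlgebra A] {H : A} (hH : IsSelfAdjoint H) :
    cay H * (1 - Complex.I • H) = 1 + Complex.I • H := by
  rw [cay, sub_mul, smul_mul_assoc, Ring.inverse_mul_cancel _ (cay_isUnit hH), two_smul]
  simp

theorem cay_unitary {A : Type} [CStarAlgebra A] {H : A} (hH : IsSelfAdjoint H) :
    cay H ∈ unitary A := by
  set N := 1 - Complex.I • H with hN
  set R := Ring.inverse N with hR
  have h1 : N * R = 1 := Ring.mul_inverse_cancel _ (cay_isUnit hH)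
  have h2 : R * N = 1 := Ring.inverse_mul_cancel _ (cay_isUnit hH)
  have hN2 : N + star N = (2:ℂ) • (1:A) := by
    rw [hN]; simp [star_smul, hH.star_eq, two_smul]
  have h3 : star R * star N = 1 := by rw [← star_mul, h1, star_one]
  have h4 : star N * star R = 1 := by rw [← star_mul, h2, star_one]
  have e1 : (2:ℂ) • (star R * R) = R + star R := by
    have : star R * (N + star N) * R = (2:ℂ) • (star R * R) := by
      rw [hN2, mul_smul_comm, mul_one, smul_mul_assoc]
    rw [← this, mul_add, add_mul, mul_assoc, h1, mul_one, h3, one_mul, add_comm]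
  have e2 : (2:ℂ) • (R * star R) = R + star R := by
    have : R * (N + star N) * star R = (2:ℂ) • (R * star R) := by
      rw [hN2, mul_smul_comm, mul_one, smul_mul_assoc]
    rw [← this, mul_add, add_mul, h2, one_mul, mul_assoc, h4, mul_one, add_comm]
  have hs : star (cay H) = (2:ℂ) • star R - 1 := by
    simp [cay, star_sub, star_smul, hR, hN]
  have hc : cay H = (2:ℂ) • R - 1 := rfl
  rw [Unitary.mem_iff]
  constructor
  · rw [hs, hc, sub_mul, mul_sub, smul_mul_smul_comm, ← smul_smul, e1, smul_add]
    simp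
  · rw [hs, hc, sub_mul, mul_sub, smul_mul_smul_comm, ← smul_smul, e2, smul_add]
    simp

theorem cay_map {A : Type} [CStarAlgebra A] {H : A} (hH : IsSelfAdjoint H) (φ : A ≃⋆ₐ[ℂ] A) :
    φ (cay H) = cay (φ H) := by
  have h1 := cay_mul hH
  have h2 := cay_mul (hH.map φ)
  have h3 := congrArg φ h1
  simp only [map_mul, map_sub, map_add, map_one, map_smul] at h3
  exact (cay_isUnit (hH.map φ)).mul_right_cancel (h3.trans h2.symm)

theorem unitary_norm_le {A : Type} [CStarAlgebra A] {v : A} (hv : v ∈ unitary A) : ‖v‖ ≤ 1 :=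
  iso_norm_le (Unitary.star_mul_self_of_mem hv)

theorem cay_lip {A : Type} [CStarAlgebra A] [Nontrivial A] {H H' : A} (hH : IsSelfAdjoint H) (hH' : IsSelfAdjoint H') :
    ‖cay H - cay H'‖ ≤ 2 * ‖H - H'‖ := by
  have hR : ∀ {K : A}, IsSelfAdjoint K → ‖Ring.inverse (1 - Complex.I • K)‖ ≤ 1 := by
    intro K hK
    have h1 : (2:ℂ) • Ring.inverse (1 - Complex.I • K) = cay K + 1 := by simp [cay]
    have h2 : ‖(2:ℂ) • Ring.inverse (1 - Complex.I • K)‖ ≤ 1 + 1 := by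
      rw [h1]
      exact (norm_add_le _ _).trans (add_le_add (unitary_norm_le (cay_unitary hK)) (by simp))
    rw [norm_smul] at h2
    norm_num at h2
    exact h2
  have h1 : cay H - cay H' = (2:ℂ) • (Ring.inverse (1 - Complex.I • H) * (Complex.I • (H - H')) * Ring.inverse (1 - Complex.I • H')) := by
    have : Complex.I • (H - H') = (1 - Complex.I • H') - (1 - Complex.I • H) := by
      rw [smul_sub]; abel
    rw [this, mul_sub, Ring.inverse_mul_cancel _ (cay_isUnit hH), sub_mul, mul_assoc,
      Ring.mul_inverse_cancel _ (cay_isUnit hH'), cay, cay, smul_sub]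
    simp
  have h2 : ‖(2:ℂ)‖ = 2 := by norm_num
  rw [h1, norm_smul, h2]
  gcongr
  calc ‖Ring.inverse (1 - Complex.I • H) * (Complex.I • (H - H')) * Ring.inverse (1 - Complex.I • H')‖
      ≤ ‖Ring.inverse (1 - Complex.I • H)‖ * ‖Complex.I • (H - H')‖ * ‖Ring.inverse (1 - Complex.I • H')‖ :=
        (norm_mul_le _ _).trans (by gcongr; exact norm_mul_le _ _)
    _ ≤ 1 * ‖Complex.I • (H - H')‖ * 1 := by gcongr; exact hR hH; exact hR hH'
    _ = ‖H - H'‖ := by rw [norm_smul]; simp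

theorem norm_mul_unitary_le {A : Type} [CStarAlgebra A] {v : A} (hv : v ∈ unitary A) (x : A) :
    ‖v * x‖ = ‖x‖ := norm_iso_mul x (Unitary.star_mul_self_of_mem hv)

theorem final_est {A : Type} [CStarAlgebra A] [Nontrivial A] (H H' b b' t1 t2 : A) (hH : IsSelfAdjoint H)
    (hH' : IsSelfAdjoint H') (ht1 : star t1 * t1 = 1) (ht2 : star t2 * t2 = 1)
    (l1 l2 ν η δ : ℝ) (hν : 0 ≤ ν)
    (h1 : ‖H * t1 - t2‖ ≤ ν) (h2 : ‖H * t2 - t1‖ ≤ ν) (h3 : ‖H' * t1‖ ≤ ν)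
    (hb1 : ‖b * t1 - l1 • t1‖ ≤ η) (hb2 : ‖b * t2 - l2 • t2‖ ≤ η) (hbb : ‖b' - b‖ ≤ δ)
    (hbn : ‖b'‖ ≤ ‖b‖) (hl1 : |l1| ≤ ‖b‖) (hl2 : |l2| ≤ ‖b‖) :
    |l1 - l2| - δ - 2 * η - 8 * ‖b‖ * ν ≤
      ‖cay H' * b' * star (cay H') - cay H * b * star (cay H)‖ := by
  set v := cay H with hv
  set w := cay H' with hw
  have hvu : v ∈ unitary A := cay_unitary hH
  have hwu : w ∈ unitary A := cay_unitary hH'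
  have hvs : star v ∈ unitary A := Unitary.star_mem hvu
  have hws : star w ∈ unitary A := Unitary.star_mem hwu
  have hvm := cay_mul hH
  have hwm := cay_mul hH'
  rw [← hv] at hvm
  rw [← hw] at hwm
  have hI : Complex.I * Complex.I = -1 := Complex.I_mul_I
  -- v t2 ≈ i t1
  have a1 : ‖v * t2 - Complex.I • t1‖ ≤ 2 * ν := by
    set e1 := H * t1 - t2 with he1
    set e2 := H * t2 - t1 with he2
    have k1 : H * t1 = e1 + t2 := by rw [he1]; abel
    have k2 : H * t2 = e2 + t1 := by rw [he2]; abel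
    have e : v * ((1 - Complex.I • H) * (t2 + Complex.I • t1)) = (1 + Complex.I • H) * (t2 + Complex.I • t1) := by
      rw [← mul_assoc, hvm]
    have f1 : (1 - Complex.I • H) * (t2 + Complex.I • t1) = (2:ℂ) • t2 + (e1 - Complex.I • e2) := by
      simp only [sub_mul, one_mul, mul_add, smul_mul_assoc, mul_smul_comm, k1, k2, smul_add, smul_sub, smul_smul, hI, two_smul, neg_smul, one_smul]
      abel
    have f2 : (1 + Complex.I • H) * (t2 + Complex.I • t1) = (2:ℂ) • (Complex.I • t1) - (e1 - Complex.I • e2) := by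
      simp only [add_mul, one_mul, mul_add, smul_mul_assoc, mul_smul_comm, k1, k2, smul_add, smul_smul, hI, two_smul, neg_smul, one_smul]
      simp only [two_mul, add_smul]
      abel
    rw [f1, f2, mul_add, mul_smul_comm] at e
    have g : (2:ℂ) • (v * t2 - Complex.I • t1) = -(e1 - Complex.I • e2) - v * (e1 - Complex.I • e2) := by
      rw [smul_sub, eq_sub_iff_add_eq.2 e]; abel
    have g2 : ‖e1 - Complex.I • e2‖ ≤ 2 * ν := by
      refine (norm_sub_le _ _).trans ?_
      rw [norm_smul, Complex.norm_I]; linarith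
    have g3 : ‖(2:ℂ) • (v * t2 - Complex.I • t1)‖ ≤ 2 * ν + 2 * ν := by
      rw [g]
      refine (norm_sub_le _ _).trans ?_
      rw [norm_neg, norm_mul_unitary_le hvu]; linarith
    rw [norm_smul] at g3
    norm_num at g3
    linarith
  have a2 : ‖star v * t1 + Complex.I • t2‖ ≤ 2 * ν := by
    rw [← norm_mul_unitary_le hvu]
    have : v * (star v * t1 + Complex.I • t2) = Complex.I • (v * t2 - Complex.I • t1) := by
      rw [mul_add, ← mul_assoc, Unitary.mul_star_self_of_mem hvu, smul_sub, smul_smul, hI, mul_smul_comm]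
      simp; abel
    rw [this, norm_smul, Complex.norm_I, one_mul]
    exact a1
  have a3 : ‖w * t1 - t1‖ ≤ 2 * ν := by
    have e : w * ((1 - Complex.I • H') * t1) = (1 + Complex.I • H') * t1 := by
      rw [← mul_assoc, hwm]
    simp only [add_mul, sub_mul, one_mul, smul_mul_assoc, mul_sub] at e
    have : w * t1 - t1 = Complex.I • (H' * t1) + w * (Complex.I • (H' * t1)) := by
      rw [sub_eq_iff_eq_add] at e
      rw [e]; abel
    rw [this]
    refine (norm_add_le _ _).trans ?_
    rw [norm_mul_unitary_le hwu, norm_smul, Complex.norm_I]; linarith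
  have a4 : ‖star w * t1 - t1‖ ≤ 2 * ν := by
    rw [← norm_mul_unitary_le hwu, mul_sub, ← mul_assoc, Unitary.mul_star_self_of_mem hwu, one_mul, norm_sub_rev]
    exact a3
  have a5 : ‖v * b * star v * t1 - l2 • t1‖ ≤ 4 * ‖b‖ * ν + η := by
    have : v * b * star v * t1 - l2 • t1 = v * (b * (star v * t1 + Complex.I • t2))
        + (-Complex.I) • (v * (b * t2 - l2 • t2)) + (-Complex.I) • l2 • (v * t2 - Complex.I • t1) := by
      simp only [mul_add, mul_sub, smul_sub, mul_smul_comm, mul_assoc, neg_smul]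
      rw [smul_comm Complex.I l2 (Complex.I • t1), smul_smul Complex.I Complex.I, hI]
      simp; abel
    rw [this]
    refine norm_add₃_le.trans ?_
    rw [norm_smul, norm_smul, norm_smul, norm_mul_unitary_le hvu, norm_mul_unitary_le hvu, norm_neg, Complex.norm_I, one_mul, one_mul, Real.norm_eq_abs]
    have b1 : ‖b * (star v * t1 + Complex.I • t2)‖ ≤ ‖b‖ * (2 * ν) :=
      (norm_mul_le _ _).trans (by gcongr)
    have b2 : |l2| * ‖v * t2 - Complex.I • t1‖ ≤ ‖b‖ * (2 * ν) := by gcongr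
    linarith
  have a6 : ‖w * b' * star w * t1 - l1 • t1‖ ≤ 4 * ‖b‖ * ν + η + δ := by
    have : w * b' * star w * t1 - l1 • t1 = w * (b' * (star w * t1 - t1)) + w * ((b' - b) * t1)
        + (w * (b * t1 - l1 • t1) + l1 • (w * t1 - t1)) := by
      simp only [mul_sub, sub_mul, smul_sub, mul_smul_comm, mul_assoc]
      abel
    rw [this]
    refine norm_add₃_le.trans ?_
    have b1 : ‖w * (b' * (star w * t1 - t1))‖ ≤ ‖b‖ * (2 * ν) := by
      rw [norm_mul_unitary_le hwu]
      exact (norm_mul_le _ _).trans (by gcongr)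
    have b2 : ‖w * ((b' - b) * t1)‖ ≤ δ := by
      rw [norm_mul_unitary_le hwu]
      exact (norm_mul_iso_le _ ht1).trans hbb
    have b3 : ‖w * (b * t1 - l1 • t1) + l1 • (w * t1 - t1)‖ ≤ η + ‖b‖ * (2 * ν) := by
      refine (norm_add_le _ _).trans ?_
      rw [norm_mul_unitary_le hwu, norm_smul, Real.norm_eq_abs]
      gcongr
    linarith
  have a7 : |l1 - l2| ≤ ‖(l1 - l2) • t1‖ := by
    rw [norm_smul, Real.norm_eq_abs]
    have : ‖t1‖ * ‖t1‖ = 1 := by rw [← CStarRing.norm_star_mul_self, ht1, norm_one]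
    have : ‖t1‖ = 1 := by nlinarith [norm_nonneg t1]
    rw [this, mul_one]
  have a8 : (l1 - l2) • t1 = (w * b' * star w - v * b * star v) * t1 - (w * b' * star w * t1 - l1 • t1)
      + (v * b * star v * t1 - l2 • t1) := by
    rw [sub_smul, sub_mul]; abel
  have a9 := norm_mul_iso_le (w * b' * star w - v * b * star v) ht1
  have a10 : ‖(l1 - l2) • t1‖ ≤ ‖(w * b' * star w - v * b * star v) * t1‖ + ‖w * b' * star w * t1 - l1 • t1‖ + ‖v * b * star v * t1 - l2 • t1‖ := by
    rw [a8]
    exact (norm_add_le _ _).trans (by gcongr; exact norm_sub_le _ _)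
  linarith


theorem aut_norm {A : Type} [CStarAlgebra A] (φ : A ≃⋆ₐ[ℂ] A) (x : A) : ‖φ x‖ = ‖x‖ :=
  NonUnitalStarAlgHom.norm_map φ φ.injective x

theorem aut_rsmul {A : Type} [CStarAlgebra A] (φ : A ≃⋆ₐ[ℂ] A) (c : ℝ) (x : A) :
    φ (c • x) = c • φ x := by
  rw [← Complex.coe_smul, map_smul, Complex.coe_smul]

theorem sum_sq {A : Type} [CStarAlgebra A] {ι : Type} (L : Finset ι) (x : ι → A) (θ : ℝ)
    (hθ0 : 0 ≤ θ) (h : ∀ j ∈ L, ∀ k ∈ L, j ≠ k → ‖x j * x k‖ ≤ θ) :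
    ‖(∑ k ∈ L, x k) * (∑ k ∈ L, x k) - ∑ k ∈ L, x k * x k‖ ≤ (L.card : ℝ) ^ 2 * θ := by
  classical
  have e : (∑ k ∈ L, x k) * (∑ k ∈ L, x k) - ∑ k ∈ L, x k * x k
      = ∑ j ∈ L, ∑ k ∈ L, (if j = k then 0 else x j * x k) := by
    rw [Finset.sum_mul_sum, ← Finset.sum_sub_distrib]
    refine Finset.sum_congr rfl fun j hj => ?_
    have : x j * x j = ∑ k ∈ L, if j = k then x j * x k else 0 := by
      rw [Finset.sum_ite_eq, if_pos hj]
    rw [this, ← Finset.sum_sub_distrib]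
    refine Finset.sum_congr rfl fun k hk => ?_
    split_ifs <;> simp
  rw [e]
  have : ∀ j ∈ L, ‖∑ k ∈ L, (if j = k then 0 else x j * x k)‖ ≤ L.card • θ := by
    intro j hj
    refine (norm_sum_le _ _).trans (Finset.sum_le_card_nsmul _ _ _ fun k hk => ?_)
    split_ifs with hjk
    · simpa using hθ0
    · exact h j hj k hk hjk
  refine (norm_sum_le _ _).trans ((Finset.sum_le_card_nsmul _ _ _ this).trans (le_of_eq ?_))
  simp only [nsmul_eq_mul]
  ring

theorem orth_sum {A : Type} [CStarAlgebra A] {ι : Type} (L : Finset ι) (h : ι → A)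
    (hsa : ∀ k ∈ L, IsSelfAdjoint (h k)) (hq : ∀ k ∈ L, h k * h k * (h k * h k) = h k * h k)
    (hn : ∀ k ∈ L, ‖h k‖ ≤ 1)
    (θ : ℝ) (hθ0 : 0 ≤ θ) (hθ : ∀ j ∈ L, ∀ k ∈ L, j ≠ k → ‖h j * h k‖ ≤ θ)
    (hnθ : (L.card : ℝ) ^ 2 * θ ≤ 1) (d : ι → ℝ) (D : ℝ) (hD : 0 ≤ D) (hd : ∀ k ∈ L, |d k| ≤ D) :
    ‖∑ k ∈ L, d k • h k‖ ≤ 2 * D := by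
  let _ := CStarAlgebra.spectralOrder A
  let _ := CStarAlgebra.spectralOrderedRing A
  have hqsa : ∀ k ∈ L, 0 ≤ h k * h k := fun k hk => by
    have := star_mul_self_nonneg (h k)
    rwa [(hsa k hk).star_eq] at this
  set S := ∑ k ∈ L, h k * h k with hS
  have hS0 : 0 ≤ S := Finset.sum_nonneg hqsa
  have h1 := sum_sq L (fun k => h k * h k) θ hθ0 (fun j hj k hk hjk => by
    have e : h j * h j * (h k * h k) = h j * (h j * h k) * h k := by simp only [mul_assoc]
    rw [e]
    calc ‖h j * (h j * h k) * h k‖ ≤ ‖h j‖ * ‖h j * h k‖ * ‖h k‖ :=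
          (norm_mul_le _ _).trans (by gcongr; exact norm_mul_le _ _)
      _ ≤ 1 * θ * 1 := by
          gcongr
          · exact hn j hj
          · exact hθ j hj k hk hjk
          · exact hn k hk
      _ = θ := by ring)
  rw [Finset.sum_congr rfl hq, ← hS] at h1
  have hSS : ‖S * S‖ = ‖S‖ * ‖S‖ := by
    have := CStarRing.norm_star_mul_self (x := S)
    rwa [(IsSelfAdjoint.of_nonneg hS0).star_eq] at this
  have h2 : ‖S‖ * ‖S‖ ≤ ‖S‖ + 1 := by
    rw [← hSS]
    calc ‖S * S‖ = ‖(S * S - S) + S‖ := by rw [sub_add_cancel]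
      _ ≤ ‖S * S - S‖ + ‖S‖ := norm_add_le _ _
      _ ≤ 1 + ‖S‖ := by gcongr; exact h1.trans hnθ
      _ = _ := add_comm _ _
  have h3 : ‖S‖ ≤ 2 := by nlinarith [norm_nonneg S]
  set T := ∑ k ∈ L, d k • h k with hT
  have hTsa : IsSelfAdjoint T := by
    rw [IsSelfAdjoint, hT, star_sum]
    refine Finset.sum_congr rfl fun k hk => ?_
    rw [star_smul, (hsa k hk).star_eq, star_trivial]
  have hTT : ‖T * T‖ = ‖T‖ * ‖T‖ := by
    have := CStarRing.norm_star_mul_self (x := T)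
    rwa [hTsa.star_eq] at this
  have h4 := sum_sq L (fun k => d k • h k) (D * D * θ) (by positivity) (fun j hj k hk hjk => by
    rw [smul_mul_smul_comm, norm_smul, Real.norm_eq_abs, abs_mul]
    gcongr
    · exact hd j hj
    · exact hd k hk
    · exact hθ j hj k hk hjk)
  rw [← hT] at h4
  have h5 : ‖∑ k ∈ L, d k • h k * d k • h k‖ ≤ D * D * 2 := by
    have h6 : ‖(D * D) • S‖ ≤ D * D * 2 := by
      rw [norm_smul, Real.norm_of_nonneg (by positivity)]; gcongr
    refine le_trans (CStarAlgebra.norm_le_norm_of_nonneg_of_le ?_ ?_) h6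
    · refine Finset.sum_nonneg fun k hk => ?_
      rw [smul_mul_smul_comm]
      exact smul_nonneg (mul_self_nonneg _) (hqsa k hk)
    · rw [hS, Finset.smul_sum]
      refine Finset.sum_le_sum fun k hk => ?_
      rw [smul_mul_smul_comm]
      refine smul_le_smul_of_nonneg_right ?_ (hqsa k hk)
      have := hd k hk
      rw [← abs_mul_abs_self]
      gcongr
  have h7 : ‖T‖ * ‖T‖ ≤ 3 * (D * D) := by
    rw [← hTT]
    calc ‖T * T‖ = ‖(T * T - ∑ k ∈ L, d k • h k * d k • h k) + ∑ k ∈ L, d k • h k * d k • h k‖ := by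
          rw [sub_add_cancel]
      _ ≤ (L.card : ℝ) ^ 2 * (D * D * θ) + D * D * 2 := (norm_add_le _ _).trans (add_le_add h4 h5)
      _ = D * D * ((L.card : ℝ) ^ 2 * θ) + D * D * 2 := by ring
      _ ≤ D * D * 1 + D * D * 2 := by gcongr
      _ = _ := by ring
  by_contra hcon
  push Not at hcon
  nlinarith [norm_nonneg T]

open scoped Pointwise in
theorem slow_fun {G : Type} [Group G] (F : Finset G) (ε : ℝ) (hε : 0 < ε) :
    ∃ (c : G → ℝ) (K : Finset G), c 1 = 1 ∧ (∀ g, |c g| ≤ 1) ∧ (∀ g, g ∉ K → c g = 0) ∧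
      ∀ f ∈ F, ∀ g, |c (f⁻¹ * g) - c g| ≤ ε := by
  classical
  obtain ⟨N, hN⟩ := exists_nat_gt (1 / ε)
  have hN0 : (0:ℝ) < N := lt_trans (by positivity) hN
  set S : Finset G := insert 1 (F ∪ F⁻¹) with hS
  have h1 : ∀ n : ℕ, (1:G) ∈ S ^ n := fun n => by
    have : (1:G) ∈ S := by simp [hS]
    simpa using Finset.pow_mem_pow this (n := n)
  set m : G → ℝ := fun g => ∑ n ∈ Finset.range N, if g ∈ S ^ n then (1:ℝ) else 0 with hm
  have hm0 : ∀ g, 0 ≤ m g := fun g => Finset.sum_nonneg fun n _ => by split_ifs <;> norm_num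
  have hmN : ∀ g, m g ≤ N := fun g => by
    have : m g ≤ (Finset.range N).card • (1:ℝ) :=
      Finset.sum_le_card_nsmul _ _ _ fun n _ => by split_ifs <;> norm_num
    simpa using this
  have key : ∀ f ∈ S, ∀ g, m g ≤ m (f * g) + 1 := by
    intro f hf g
    have e1 : m g ≤ ∑ n ∈ Finset.range N, if f * g ∈ S ^ (n + 1) then (1:ℝ) else 0 := by
      refine Finset.sum_le_sum fun n _ => ?_
      by_cases hg : g ∈ S ^ n
      · rw [if_pos hg, if_pos]
        rw [pow_succ']
        exact Finset.mul_mem_mul hf hg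
      · rw [if_neg hg]
        split_ifs <;> norm_num
    have e2 := Finset.sum_range_succ (fun n => if f * g ∈ S ^ n then (1:ℝ) else 0) N
    have e3 := Finset.sum_range_succ' (fun n => if f * g ∈ S ^ n then (1:ℝ) else 0) N
    have e4 : (if f * g ∈ S ^ N then (1:ℝ) else 0) ≤ 1 := by split_ifs <;> norm_num
    have e5 : 0 ≤ (if f * g ∈ S ^ 0 then (1:ℝ) else 0) := by split_ifs <;> norm_num
    simp only [hm] at *
    linarith
  refine ⟨fun g => m g / N, (Finset.range N).biUnion fun n => S ^ n, ?_, ?_, ?_, ?_⟩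
  · simp only [hm, h1, if_true]
    simp
    exact_mod_cast hN0.ne'
  · intro g
    rw [abs_of_nonneg (div_nonneg (hm0 g) hN0.le), div_le_one hN0]
    exact hmN g
  · intro g hg
    have : m g = 0 := Finset.sum_eq_zero fun n hn => by
      rw [if_neg]
      intro h
      exact hg (Finset.mem_biUnion.2 ⟨n, hn, h⟩)
    simp [this]
  · intro f hf g
    have k1 := key f (by simp [hS, hf]) (f⁻¹ * g)
    have k2 := key f⁻¹ (by simp [hS, hf]) g
    rw [mul_inv_cancel_left] at k1
    rw [← sub_div, abs_div, abs_of_pos hN0, div_le_iff₀ hN0]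
    have : 1 < ε * N := by
      rw [div_lt_iff₀ hε] at hN; linarith
    rw [abs_le]; constructor <;> linarith


open scoped Pointwise in
theorem move_lemma {A : Type} [CStarAlgebra A] [Nontrivial A]
    (hPI : ∀ a : A, a ≠ 0 → ∃ x y : A, x * a * y = 1)
    (x₀ y₀ : A) (hx₀ : star x₀ * x₀ = 1) (hy₀ : star y₀ * y₀ = 1) (hxy : star x₀ * y₀ = 0)
    {G : Type} [Group G] [Infinite G] (β : G → A ≃⋆ₐ[ℂ] A)
    (β1 : ∀ a, β 1 a = a) (βm : ∀ g h a, β (g * h) a = β g (β h a))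
    (hout : ∀ g : G, g ≠ 1 → ¬ ∃ u : A, u ∈ unitary A ∧ ∀ a : A, β g a = u * a * star u)
    (b : A) (hb : IsSelfAdjoint b) (l : Bool → ℝ) (hl : ∀ i, l i ∈ spectrum ℝ b)
    (δ : ℝ) (hδ : 0 < δ) (hll : 6 * δ ≤ |l true - l false|)
    (hfix : ∀ g, ‖β g b - b‖ ≤ 2 * δ) (F : Finset G) (ε : ℝ) (hε : 0 < ε) :
    ∃ v ∈ unitary A, (∀ g ∈ F, ‖β g v - v‖ < ε) ∧
      ∃ g, 2 * δ < ‖β g (v * b * star v) - v * b * star v‖ := by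
  classical
  obtain ⟨c, K, c1, cle, csupp, cF⟩ := slow_fun F (ε / 8) (by positivity)
  obtain ⟨g0, hg0⟩ := Infinite.exists_notMem_finset (K⁻¹)
  rw [Finset.mem_inv'] at hg0
  have h1K : (1:G) ∈ K := by
    by_contra h
    rw [csupp 1 h] at c1
    norm_num at c1
  set L : Finset G := insert 1 F * K with hL
  have hKL : K ⊆ L := fun k hk => by
    have := Finset.mul_mem_mul (Finset.mem_insert_self 1 F) hk
    rwa [one_mul] at this
  set T : Finset G := L ∪ K.image (fun k => g0 * k) with hT
  have hLT : L ⊆ T := Finset.subset_union_left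
  have h1T : (1:G) ∈ T := hLT (hKL h1K)
  set D : Finset G := (T⁻¹ * T).erase 1 with hD
  have hTD : ∀ j ∈ T, ∀ k ∈ T, j ≠ k → j⁻¹ * k ∈ D := by
    intro j hj k hk hjk
    refine Finset.mem_erase.2 ⟨?_, Finset.mul_mem_mul (Finset.inv_mem_inv hj) hk⟩
    intro h
    exact hjk (inv_mul_eq_one.1 h)
  have hTD1 : ∀ k ∈ T, k ≠ 1 → k ∈ D := by
    intro k hk hk1
    have := hTD 1 h1T k hk (Ne.symm hk1)
    simpa using this
  -- the eigen isometries
  have hS : ∀ i, ∃ s z : A, s = cfc (bumpAt (l i) (δ / 4)) b * z ∧ star s * s = 1 ∧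
      ‖b * s - l i • s‖ ≤ δ / 4 := fun i => pi_eig hPI b hb (l i) (hl i) (δ / 4) (by positivity)
  choose s z hsz hs hbs using hS
  have hbump : ∀ i j, i ≠ j → star (s i) * s j = 0 := by
    intro i j hij
    have hll2 : 2 * (δ / 4) ≤ |l i - l j| := by
      cases i <;> cases j
      · exact absurd rfl hij
      · rw [abs_sub_comm]; linarith
      · linarith
      · exact absurd rfl hij
    have := bump_mul b (l i) (l j) (δ / 4) hll2
    have hsac : IsSelfAdjoint (cfc (bumpAt (l i) (δ / 4)) b) := cfc_predicate _ _
    rw [hsz i, hsz j, star_mul, hsac.star_eq, mul_assoc, ← mul_assoc (cfc _ b), this]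
    simp
  obtain ⟨η, hη, hη1, hη2⟩ : ∃ η : ℝ, 0 < η ∧ (L.card : ℝ) ^ 2 * (4 * η) ≤ 1 ∧
      8 * ‖b‖ * (K.card * (2 * η)) ≤ δ := by
    refine ⟨min (1 / (4 * ((L.card : ℝ) ^ 2 + 1))) (δ / (16 * ‖b‖ * K.card + 1)), ?_, ?_, ?_⟩
    · refine lt_min (by positivity) (by positivity)
    · calc (L.card : ℝ) ^ 2 * (4 * min (1 / (4 * ((L.card : ℝ) ^ 2 + 1))) (δ / (16 * ‖b‖ * K.card + 1)))
          ≤ ((L.card : ℝ) ^ 2 + 1) * (4 * (1 / (4 * ((L.card : ℝ) ^ 2 + 1)))) := by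
            have := min_le_left (1 / (4 * ((L.card : ℝ) ^ 2 + 1))) (δ / (16 * ‖b‖ * K.card + 1))
            gcongr
            linarith
        _ = 1 := by field_simp
    · calc 8 * ‖b‖ * (K.card * (2 * min (1 / (4 * ((L.card : ℝ) ^ 2 + 1))) (δ / (16 * ‖b‖ * K.card + 1))))
          = (16 * ‖b‖ * K.card) * min (1 / (4 * ((L.card : ℝ) ^ 2 + 1))) (δ / (16 * ‖b‖ * K.card + 1)) := by ring
        _ ≤ (16 * ‖b‖ * K.card + 1) * (δ / (16 * ‖b‖ * K.card + 1)) := by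
            have := min_le_right (1 / (4 * ((L.card : ℝ) ^ 2 + 1))) (δ / (16 * ‖b‖ * K.card + 1))
            gcongr
            linarith
        _ = δ := by field_simp
  obtain ⟨r, hr, hrS⟩ := kish_list hPI x₀ y₀ hx₀ hy₀ hxy
    (ι := G × Bool × Bool) (fun p => β p.1) (fun p => star (s p.2.1) * β p.1 (s p.2.2)) η hη
    (D ×ˢ Finset.univ) (by
      rintro ⟨d, i, j⟩ hd
      rw [Finset.mem_product] at hd
      exact hout d (Finset.mem_erase.1 hd.1).1)
  set t : Bool → A := fun i => s i * r with ht
  have tt : ∀ i, star (t i) * t i = 1 := fun i => iso_mul (hs i) hr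
  have tij : ∀ i j, i ≠ j → star (t i) * t j = 0 := by
    intro i j hij
    have : star (t i) * t j = star r * (star (s i) * s j) * r := by simp [ht, mul_assoc]
    rw [this, hbump i j hij]; simp
  have tβ : ∀ d ∈ D, ∀ i j, ‖star (t i) * β d (t j)‖ ≤ η := by
    intro d hd i j
    have := hrS (d, i, j) (Finset.mem_product.2 ⟨hd, Finset.mem_univ _⟩)
    simp only at this
    have e : star (t i) * β d (t j) = star r * (star (s i) * β d (s j)) * β d r := by
      simp [ht, mul_assoc]
    rw [e]; exact this.le
  have tb : ∀ i, ‖b * t i - l i • t i‖ ≤ δ / 4 := by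
    intro i
    have : b * t i - l i • t i = (b * s i - l i • s i) * r := by
      simp [ht, sub_mul, mul_assoc]
    rw [this]
    exact (norm_mul_iso_le _ hr).trans (hbs i)
  clear_value t
  set t1 := t true with ht1
  set t2 := t false with ht2
  have t11 : star t1 * t1 = 1 := tt _
  have t22 : star t2 * t2 = 1 := tt _
  have t12 : star t1 * t2 = 0 := tij _ _ (by simp)
  have t21 : star t2 * t1 = 0 := tij _ _ (by simp)
  set h : A := t1 * star t2 + t2 * star t1 with hh
  have hsa : IsSelfAdjoint h := by
    rw [IsSelfAdjoint, hh]; simp [add_comm]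
  have ht1' : h * t1 = t2 := by
    rw [hh, add_mul, mul_assoc, mul_assoc, t21, t11]; simp
  have ht2' : h * t2 = t1 := by
    rw [hh, add_mul, mul_assoc, mul_assoc, t22, t12]; simp
  have hhh : h * h = t1 * star t1 + t2 * star t2 := by
    nth_rewrite 2 [hh]
    rw [mul_add, ← mul_assoc, ← mul_assoc, ht1', ht2', add_comm]
  have hidem : h * h * (h * h) = h * h := by
    have e1 : h * h * t1 = t1 := by rw [mul_assoc, ht1', ht2']
    have e2 : h * h * t2 = t2 := by rw [mul_assoc, ht2', ht1']
    nth_rewrite 2 [hhh]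
    rw [mul_add, ← mul_assoc, ← mul_assoc, e1, e2, hhh]
  have hn : ‖h‖ ≤ 1 := by
    have e1 : ‖h * h‖ = ‖h‖ * ‖h‖ := by
      have := CStarRing.norm_star_mul_self (x := h)
      rwa [hsa.star_eq] at this
    have hsa2 : star (h * h) = h * h := by rw [star_mul, hsa.star_eq]
    have e2 : ‖h * h‖ = ‖h * h‖ * ‖h * h‖ := by
      have := CStarRing.norm_star_mul_self (x := h * h)
      rwa [hsa2, hidem] at this
    by_contra hcon
    push Not at hcon
    have e3 : 1 < ‖h * h‖ := by rw [e1]; nlinarith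
    nlinarith
  have th : ∀ d ∈ D, ∀ i, ‖star (t i) * β d h‖ ≤ 2 * η := by
    intro d hd i
    have : star (t i) * β d h = star (t i) * β d t1 * star (β d t2) + star (t i) * β d t2 * star (β d t1) := by
      rw [hh, ← map_star, ← map_star]; simp only [map_add, map_mul, mul_add, mul_assoc]
    rw [this]
    have k : ∀ (x y : A), star y * y = 1 → ‖x * star y‖ ≤ ‖x‖ := by
      intro x y hy
      refine (norm_mul_le _ _).trans ?_
      rw [norm_star]
      have := iso_norm_le hy
      nlinarith [norm_nonneg x]
    have k1 := (k (star (t i) * β d t1) (β d t2) (iso_map _ t22)).trans (tβ d hd i true)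
    have k2 := (k (star (t i) * β d t2) (β d t1) (iso_map _ t11)).trans (tβ d hd i false)
    refine (norm_add_le _ _).trans ?_
    linarith
  have ht : ∀ d ∈ D, ∀ i, ‖β d h * t i‖ ≤ 2 * η := by
    intro d hd i
    have := th d hd i
    rw [← norm_star] at this
    rwa [star_mul, star_star, (hsa.map (β d)).star_eq] at this
  have hβh : ∀ d ∈ D, ‖h * β d h‖ ≤ 4 * η := by
    intro d hd
    have : h * β d h = t1 * (star t2 * β d h) + t2 * (star t1 * β d h) := by
      nth_rewrite 1 [hh]
      rw [add_mul, mul_assoc, mul_assoc]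
    rw [this]
    refine (norm_add_le _ _).trans ?_
    rw [norm_iso_mul _ t11, norm_iso_mul _ t22]
    have k1 := th d hd true
    have k2 := th d hd false
    linarith
  have hjk : ∀ j ∈ L, ∀ k ∈ L, j ≠ k → ‖β j h * β k h‖ ≤ 4 * η := by
    intro j hj k hk hjk
    have : β j h * β k h = β j (h * β (j⁻¹ * k) h) := by
      rw [map_mul, ← βm, mul_inv_cancel_left]
    rw [this, aut_norm]
    exact hβh _ (hTD j (hLT hj) k (hLT hk) hjk)
  set H : A := ∑ k ∈ K, c k • β k h with hH
  have Hsa : IsSelfAdjoint H := by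
    rw [IsSelfAdjoint, hH, star_sum]
    refine Finset.sum_congr rfl fun k hk => ?_
    rw [star_smul, (hsa.map (β k)).star_eq, star_trivial]
  have hHt : ∀ i, ‖H * t i - h * t i‖ ≤ K.card * (2 * η) := by
    intro i
    have e : H * t i - h * t i = ∑ k ∈ K.erase 1, c k • (β k h * t i) := by
      rw [hH, ← Finset.add_sum_erase K _ h1K, c1, one_smul, β1, add_mul, add_sub_cancel_left,
        Finset.sum_mul]
      simp only [smul_mul_assoc]
    rw [e]
    have e2 : ∀ k ∈ K.erase 1, ‖c k • (β k h * t i)‖ ≤ 2 * η := by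
      intro k hk
      rw [Finset.mem_erase] at hk
      rw [norm_smul, Real.norm_eq_abs]
      have := ht k (hTD1 k (hLT (hKL hk.2)) hk.1) i
      calc |c k| * ‖β k h * t i‖ ≤ 1 * (2 * η) := by gcongr; exact cle k
        _ = _ := one_mul _
    refine (norm_sum_le _ _).trans ((Finset.sum_le_card_nsmul _ _ _ e2).trans ?_)
    rw [nsmul_eq_mul]
    gcongr
    exact Finset.erase_subset _ _
  have hHt' : ‖β g0 H * t1‖ ≤ K.card * (2 * η) := by
    have e : β g0 H * t1 = ∑ k ∈ K, c k • (β (g0 * k) h * t1) := by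
      rw [hH, map_sum, Finset.sum_mul]
      refine Finset.sum_congr rfl fun k _ => ?_
      rw [aut_rsmul, βm, smul_mul_assoc]
    rw [e]
    have e2 : ∀ k ∈ K, ‖c k • (β (g0 * k) h * t1)‖ ≤ 2 * η := by
      intro k hk
      rw [norm_smul, Real.norm_eq_abs]
      have hne : g0 * k ≠ 1 := by
        intro h
        apply hg0
        rwa [inv_eq_of_mul_eq_one_right h]
      have := ht (g0 * k) (hTD1 _ (Finset.mem_union_right _ (Finset.mem_image_of_mem _ hk)) hne) true
      calc |c k| * ‖β (g0 * k) h * t1‖ ≤ 1 * (2 * η) := by gcongr; exact cle k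
        _ = _ := one_mul _
    refine (norm_sum_le _ _).trans ((Finset.sum_le_card_nsmul _ _ _ e2).trans ?_)
    rw [nsmul_eq_mul]
  have hHF : ∀ f ∈ F, ‖β f H - H‖ ≤ 2 * (ε / 8) := by
    intro f hf
    have e1 : H = ∑ m ∈ L, c m • β m h := by
      rw [hH]
      refine Finset.sum_subset hKL fun m _ hm => ?_
      rw [csupp m hm, zero_smul]
    have e2 : β f H = ∑ m ∈ L, c (f⁻¹ * m) • β m h := by
      have e3 : β f H = ∑ m ∈ K.image (fun k => f * k), c (f⁻¹ * m) • β m h := by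
        rw [Finset.sum_image (fun x _ y _ hxy => mul_left_cancel hxy), hH, map_sum]
        refine Finset.sum_congr rfl fun k _ => ?_
        rw [aut_rsmul, βm, inv_mul_cancel_left]
      rw [e3]
      refine Finset.sum_subset ?_ fun m _ hm => ?_
      · intro m hm
        obtain ⟨k, hk, rfl⟩ := Finset.mem_image.1 hm
        exact Finset.mul_mem_mul (Finset.mem_insert_of_mem hf) hk
      · rw [csupp, zero_smul]
        intro hk
        exact hm (Finset.mem_image.2 ⟨_, hk, mul_inv_cancel_left _ _⟩)
    have e4 : β f H - H = ∑ m ∈ L, (c (f⁻¹ * m) - c m) • β m h := by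
      rw [e2]
      nth_rewrite 1 [e1]
      rw [← Finset.sum_sub_distrib]
      simp only [sub_smul]
    rw [e4]
    refine orth_sum L (fun m => β m h) (fun k _ => hsa.map (β k)) (fun k _ => ?_) (fun k _ => ?_) (4 * η)
      (by positivity) hjk hη1 _ (ε / 8) (by positivity) (fun k _ => cF f hf k)
    · simp only [← map_mul, hidem]
    · rw [aut_norm]; exact hn
  refine ⟨cay H, cay_unitary Hsa, fun f hf => ?_, g0, ?_⟩
  · rw [cay_map Hsa]
    refine (cay_lip (Hsa.map _) Hsa).trans_lt ?_
    have := hHF f hf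
    linarith
  · rw [map_mul, map_mul, map_star, cay_map Hsa]
    have hlb : ∀ i, |l i| ≤ ‖b‖ := fun i => by
      have := spectrum.norm_le_norm_of_mem (hl i)
      rwa [Real.norm_eq_abs] at this
    have k1 := hHt true
    have k2 := hHt false
    rw [← ht1, ht1'] at k1
    rw [← ht2, ht2'] at k2
    have := final_est H (β g0 H) b (β g0 b) t1 t2 Hsa (Hsa.map _) t11 t22 (l true) (l false)
      (K.card * (2 * η)) (δ / 4) (2 * δ) (by positivity) k1 k2 hHt' (tb true) (tb false)
      (hfix g0) (aut_norm _ _).le (hlb _) (hlb _)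
    linarith


theorem aut_unitary {A : Type} [CStarAlgebra A] (φ : A ≃⋆ₐ[ℂ] A) {v : A} (hv : v ∈ unitary A) :
    φ v ∈ unitary A := by
  rw [Unitary.mem_iff] at hv ⊢
  rw [← map_star, ← map_mul, ← map_mul, hv.1, hv.2, map_one]
  exact ⟨rfl, rfl⟩

theorem near_scalar {A : Type} [CStarAlgebra A] [Nontrivial A] (b : A) (hb : IsSelfAdjoint b)
    (d : ℝ) (hd : 0 < d)
    (h : ¬ ∃ l : Bool → ℝ, (∀ i, l i ∈ spectrum ℝ b) ∧ d ≤ |l true - l false|) :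
    ∃ l : ℝ, ‖b - algebraMap ℝ A l‖ ≤ d := by
  obtain ⟨l, hl⟩ := ContinuousFunctionalCalculus.spectrum_nonempty (R := ℝ) b hb
  refine ⟨l, ?_⟩
  have e : b - algebraMap ℝ A l = cfc (fun x : ℝ => x - l) b := by
    rw [cfc_sub (fun x : ℝ => x) (fun _ => l) b, cfc_id' ℝ b, cfc_const l b]
  rw [e]
  refine norm_cfc_le hd.le fun x hx => ?_
  by_contra hcon
  push Not at hcon
  rw [Real.norm_eq_abs] at hcon
  refine h ⟨fun i => if i then x else l, ?_, ?_⟩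
  · intro i
    cases i
    · simpa using hl
    · simpa using hx
  · simpa using hcon.le

theorem baire_main {A : Type} [CStarAlgebra A] [Nontrivial A] [TopologicalSpace.SeparableSpace A]
    (hPI : ∀ a : A, a ≠ 0 → ∃ x y : A, x * a * y = 1)
    (x₀ y₀ : A) (hx₀ : star x₀ * x₀ = 1) (hy₀ : star y₀ * y₀ = 1) (hxy : star x₀ * y₀ = 0)
    {G : Type} [Group G] [Infinite G] [Countable G] (α : G → A ≃⋆ₐ[ℂ] A)
    (α1 : ∀ a, α 1 a = a) (αm : ∀ g h a, α (g * h) a = α g (α h a))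
    (hout : ∀ g : G, g ≠ 1 → ¬ ∃ u : A, u ∈ unitary A ∧ ∀ a : A, α g a = u * a * star u) :
    ∃ u : G → A, (∀ g, u g ∈ unitary A) ∧ (∀ g h, u g * α g (u h) = u (g * h)) ∧
      ∀ a, IsSelfAdjoint a → (∀ g, u g * α g a * star (u g) = a) → a ∈ Set.range (fun z : ℂ => z • (1:A)) := by
  classical
  have αc : ∀ g, Continuous (α g) := fun g =>
    (AddMonoidHomClass.isometry_of_norm (α g) (aut_norm (α g))).continuous
  set Z : Set (G → A) := {u | (∀ g, u g ∈ unitary A) ∧ ∀ g h, u g * α g (u h) = u (g * h)} with hZ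
  have hZc : IsClosed Z := by
    rw [hZ, Set.setOf_and, Set.setOf_forall, Set.setOf_forall]
    refine IsClosed.inter (isClosed_iInter fun g => ?_) (isClosed_iInter fun g => ?_)
    · simp only [Unitary.mem_iff, Set.setOf_and]
      exact (isClosed_eq (by fun_prop) (by fun_prop)).inter (isClosed_eq (by fun_prop) (by fun_prop))
    · rw [Set.setOf_forall]
      refine isClosed_iInter fun h => isClosed_eq ?_ (by fun_prop)
      exact (continuous_apply g).mul ((αc g).comp (continuous_apply h))
  have : CompleteSpace Z := hZc.completeSpace_coe
  have : Nonempty Z := ⟨⟨fun _ => 1, fun _ => one_mem _, fun g h => by simp⟩⟩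
  set q : ℕ → A := fun n => (1/2 : ℝ) • (TopologicalSpace.denseSeq A n + star (TopologicalSpace.denseSeq A n)) with hq
  have qsa : ∀ n, IsSelfAdjoint (q n) := fun n => by
    rw [IsSelfAdjoint, hq]; simp [add_comm]
  have qd : ∀ a, IsSelfAdjoint a → ∀ ε : ℝ, 0 < ε → ∃ n, ‖q n - a‖ < ε := by
    intro a ha ε hε
    obtain ⟨y, hn, ⟨n, rfl⟩⟩ := Metric.dense_iff.1 (TopologicalSpace.denseRange_denseSeq A) a ε hε
    refine ⟨n, ?_⟩
    rw [Metric.mem_ball, dist_eq_norm] at hn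
    set x := TopologicalSpace.denseSeq A n
    have e : q n - a = (1/2 : ℝ) • ((x - a) + star (x - a)) := by
      rw [hq, star_sub, ha.star_eq]
      have : a = (1/2 : ℝ) • (a + a) := by rw [← two_smul ℝ a, smul_smul]; norm_num
      nth_rewrite 1 [this]
      rw [← smul_sub]
      congr 1
      abel
    rw [e, norm_smul]
    have := norm_add_le (x - a) (star (x - a))
    rw [norm_star] at this
    rw [Real.norm_of_nonneg (by norm_num)]
    linarith
  set δ : ℕ → ℝ := fun m => 1 / ((m:ℝ) + 1) with hδ
  have δ0 : ∀ m, 0 < δ m := fun m => by simp only [hδ]; positivity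
  set C : ℕ × ℕ → Prop := fun p => ∃ l : Bool → ℝ, (∀ i, l i ∈ spectrum ℝ (q p.1)) ∧
    6 * δ p.2 ≤ |l true - l false| with hC
  set O : ℕ × ℕ → Set Z := fun p => {u | C p → ∃ g, 2 * δ p.2 <
    ‖u.1 g * α g (q p.1) * star (u.1 g) - q p.1‖} with hO
  have hOo : ∀ p, IsOpen (O p) := by
    intro p
    by_cases hp : C p
    · simp only [hO, hp, forall_const]
      rw [Set.ofPred_exists]
      refine isOpen_iUnion fun g => isOpen_lt continuous_const ?_
      have : Continuous fun u : Z => u.1 g := (continuous_apply g).comp continuous_subtype_val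
      exact (((this.mul continuous_const).mul (continuous_star.comp this)).sub continuous_const).norm
    · simp only [hO, hp, false_imp_iff, Set.ofPred_true]
      exact isOpen_univ
  have hOd : ∀ p, Dense (O p) := by
    intro p
    by_cases hp : C p
    swap
    · simp only [hO, hp, false_imp_iff, Set.ofPred_true]
      exact dense_univ
    rw [dense_iff_inter_open]
    rintro U hU ⟨u, hu⟩
    by_cases huO : u ∈ O p
    · exact ⟨u, hu, huO⟩
    obtain ⟨V, hV, rfl⟩ := isOpen_induced_iff.1 hU
    obtain ⟨I, W, hW, hWV⟩ := isOpen_pi_iff.1 hV u.1 hu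
    obtain ⟨ε, hε, hεW⟩ : ∃ ε : ℝ, 0 < ε ∧ ∀ i ∈ I, Metric.ball (u.1 i) ε ⊆ W i := by
      have : ∀ᶠ ε in nhdsWithin (0:ℝ) (Set.Ioi 0), ∀ i ∈ I, Metric.ball (u.1 i) ε ⊆ W i := by
        rw [Filter.eventually_all_finset]
        intro i hi
        obtain ⟨ε, hε, hb⟩ := Metric.isOpen_iff.1 (hW i hi).1 _ (hW i hi).2
        filter_upwards [Ioo_mem_nhdsGT hε] with e he
        exact (Metric.ball_subset_ball he.2.le).trans hb
      obtain ⟨ε, h1, h2⟩ := (this.and self_mem_nhdsWithin).exists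
      exact ⟨ε, h2, h1⟩
    obtain ⟨u, huu, huc⟩ := u
    simp only at *
    have u1 : u 1 = 1 := by
      have := huc 1 1
      rw [α1, mul_one] at this
      have h2 := Unitary.star_mul_self_of_mem (huu 1)
      calc u 1 = star (u 1) * (u 1 * u 1) := by rw [← mul_assoc, h2, one_mul]
        _ = 1 := by rw [this, h2]
    set β : G → A ≃⋆ₐ[ℂ] A := fun g => (α g).trans (Unitary.conjStarAlgAut ℂ A ⟨u g, huu g⟩) with hβ
    have βa : ∀ g a, β g a = u g * α g a * star (u g) := fun g a => by
      simp [hβ, Unitary.conjStarAlgAut_apply]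
    obtain ⟨l, hl, hll⟩ := hp
    have hfix : ∀ g, ‖β g (q p.1) - q p.1‖ ≤ 2 * δ p.2 := by
      intro g
      by_contra hcon
      push Not at hcon
      rw [βa] at hcon
      exact huO fun _ => ⟨g, hcon⟩
    obtain ⟨v, hv, hvI, g0, hg0⟩ := move_lemma hPI x₀ y₀ hx₀ hy₀ hxy β
      (fun a => by rw [βa, u1, α1]; simp)
      (fun g h a => by
        rw [βa, βa, βa, ← huc g h, αm]
        simp [mul_assoc, map_star])
      (fun g hg => by
        rintro ⟨w, hw, hwa⟩
        refine hout g hg ⟨star (u g) * w, mul_mem (Unitary.star_mem (huu g)) hw, fun a => ?_⟩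
        have := hwa a
        rw [βa] at this
        calc α g a = (star (u g) * u g) * α g a * (star (u g) * u g) := by
              rw [Unitary.star_mul_self_of_mem (huu g)]; simp
          _ = star (u g) * (u g * α g a * star (u g)) * u g := by simp only [mul_assoc]
          _ = _ := by rw [this]; simp [mul_assoc])
      (q p.1) (qsa p.1) l hl (δ p.2) (δ0 _) hll hfix I ε hε
    have vv := Unitary.mul_star_self_of_mem hv
    have hu' : (fun g => star v * u g * α g v) ∈ Z := by
      refine ⟨fun g => mul_mem (mul_mem (Unitary.star_mem hv) (huu g)) (aut_unitary _ hv), fun g h => ?_⟩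
      have : star v * u g * α g v * α g (star v * u h * α h v)
          = star v * u g * α g ((v * star v) * u h * α h v) := by
        simp only [map_mul, mul_assoc]
      simp only
      rw [this, vv, one_mul, map_mul, αm, ← huc]
      simp only [mul_assoc]
    refine ⟨⟨_, hu'⟩, hWV ?_, fun _ => ⟨g0, ?_⟩⟩
    · intro i hi
      refine hεW i hi ?_
      rw [Metric.mem_ball, dist_eq_norm]
      have e : star v * u i * α i v - u i = star v * ((β i v - v) * u i) := by
        rw [βa, sub_mul, mul_sub, ← mul_assoc (star v) v, Unitary.star_mul_self_of_mem hv, one_mul,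
          mul_assoc (u i * _), Unitary.star_mul_self_of_mem (huu i), mul_one, mul_assoc]
      simp only
      rw [e, CStarRing.norm_mem_unitary_mul _ (Unitary.star_mem hv), CStarRing.norm_mul_mem_unitary _ (huu i)]
      exact hvI i hi
    · simp only
      have e : star v * u g0 * α g0 v * α g0 (q p.1) * star (star v * u g0 * α g0 v) - q p.1
          = star v * ((β g0 (v * q p.1 * star v) - v * q p.1 * star v) * v) := by
        have e2 : star v * (v * q p.1 * star v * v) = q p.1 := by
          calc star v * (v * q p.1 * star v * v) = (star v * v) * q p.1 * (star v * v) := by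
                simp only [mul_assoc]
            _ = _ := by rw [Unitary.star_mul_self_of_mem hv]; simp
        rw [sub_mul, mul_sub, e2, βa]
        simp only [map_mul, map_star, star_mul, star_star, mul_assoc]
      rw [e, CStarRing.norm_mem_unitary_mul _ (Unitary.star_mem hv), CStarRing.norm_mul_mem_unitary _ hv]
      exact hg0
  obtain ⟨u, hu⟩ := (dense_iInter_of_isOpen hOo hOd).nonempty
  rw [Set.mem_iInter] at hu
  refine ⟨u.1, u.2.1, u.2.2, fun a ha hfix => ?_⟩
  have hcl : IsClosed (Set.range (fun z : ℂ => z • (1:A))) := by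
    have := (Submodule.span ℂ {(1:A)}).closed_of_finiteDimensional
    convert this using 1
    ext x
    simp [Submodule.mem_span_singleton]
  rw [← hcl.closure_eq, Metric.mem_closure_iff]
  intro ε hε
  obtain ⟨m, hm⟩ := exists_nat_one_div_lt (show 0 < ε / 7 by positivity)
  have hm' : δ m < ε / 7 := hm
  obtain ⟨n, hn⟩ := qd a ha (δ m) (δ0 m)
  have hnC : ¬ C (n, m) := by
    intro hc
    obtain ⟨g, hg⟩ := hu (n, m) hc
    simp only at hg
    have e : u.1 g * α g (q n) * star (u.1 g) - q n = u.1 g * α g (q n - a) * star (u.1 g) - (q n - a) := by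
      rw [map_sub, mul_sub, sub_mul, hfix g]; abel
    rw [e] at hg
    have := norm_sub_le (u.1 g * α g (q n - a) * star (u.1 g)) (q n - a)
    rw [CStarRing.norm_mul_mem_unitary _ (Unitary.star_mem (u.2.1 g)),
      CStarRing.norm_mem_unitary_mul _ (u.2.1 g), aut_norm] at this
    linarith
  obtain ⟨l, hl⟩ := near_scalar (q n) (qsa n) (6 * δ m) (by have := δ0 m; positivity) hnC
  refine ⟨(l:ℂ) • (1:A), ⟨_, rfl⟩, ?_⟩
  have e : (l:ℂ) • (1:A) = algebraMap ℝ A l := by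
    rw [Complex.coe_smul, Algebra.algebraMap_eq_smul_one]
  rw [e, dist_eq_norm]
  calc ‖a - algebraMap ℝ A l‖ = ‖(q n - algebraMap ℝ A l) - (q n - a)‖ := by congr 1; abel
    _ ≤ 6 * δ m + δ m := (norm_sub_le _ _).trans (add_le_add hl hn.le)
    _ < ε := by linarith

end

/-- Let `G` be a countable infinite discrete amenable group and `(A, α)` a
unital Kirchberg algebra with a point-wise outer `G`-action.  Then there is an `α`-cocycle
`u` of unitaries in `A` such that the perturbed action `α^u = (Ad u_g ∘ α_g)_g` is ergodic. -/
theorem ergodic_cocycle_perturbation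
    (G : Type) [Group G] [Countable G] [Infinite G] (hG : IsAmenableGroup G)
    (A : Type) [CStarAlgebra A] (hA : IsUnitalKirchberg A)
    (α : CStarAction G A) (hout : α.IsPointwiseOuter) :
    ∃ u : G → A, (∀ g, u g ∈ unitary A) ∧
      (∀ g h : G, u g * α.app g (u h) = u (g * h)) ∧
      ∃ γ : CStarAction G A,
        (∀ (g : G) (a : A), γ.app g a = u g * α.app g a * star (u g)) ∧
        γ.IsErgodic := by
  have hsep := hA.separable
  obtain ⟨x₀, y₀, hx₀, hy₀, hxy⟩ := hA.properly_infinite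
  have hnt : Nontrivial A := by
    obtain ⟨a, ha⟩ := hA.simple.1
    exact ⟨⟨a, 0, ha⟩⟩
  obtain ⟨u, huu, huc, hfix⟩ := baire_main hA.purely_infinite x₀ y₀ hx₀ hy₀ hxy α.app
    α.app_one α.app_mul hout
  have u1 : u 1 = 1 := by
    have := huc 1 1
    rw [α.app_one, mul_one] at this
    have h2 := Unitary.star_mul_self_of_mem (huu 1)
    calc u 1 = star (u 1) * (u 1 * u 1) := by rw [← mul_assoc, h2, one_mul]
      _ = 1 := by rw [this, h2]
  have γa : ∀ g a, ((α.app g).trans (Unitary.conjStarAlgAut ℂ A ⟨u g, huu g⟩)) a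
      = u g * α.app g a * star (u g) := fun g a => by
    simp [Unitary.conjStarAlgAut_apply]
  let γ : CStarAction G A :=
    { app := fun g => (α.app g).trans (Unitary.conjStarAlgAut ℂ A ⟨u g, huu g⟩)
      app_one := fun a => by rw [γa, u1, α.app_one]; simp
      app_mul := fun g h a => by
        rw [γa, γa, γa, ← huc g h, α.app_mul]
        simp [mul_assoc, map_star] }
  refine ⟨u, huu, huc, γ, γa, ?_⟩
  apply Set.Subset.antisymm
  · intro a ha
    have ha' : ∀ g, γ.app g a = a := ha
    have hs : ∀ g, γ.app g (star a) = star a := fun g => by rw [map_star, ha' g]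
    obtain ⟨z1, h1⟩ := hfix (a + star a) (by rw [IsSelfAdjoint]; simp [add_comm]) (fun g => by
      rw [← γa]
      change γ.app g _ = _
      rw [map_add, ha', hs])
    obtain ⟨z2, h2⟩ := hfix (Complex.I • (a - star a)) (by rw [IsSelfAdjoint]; simp [smul_sub]; abel) (fun g => by
      rw [← γa]
      change γ.app g _ = _
      rw [map_smul, map_sub, ha', hs])
    simp only at h1 h2
    refine ⟨(1/2 : ℂ) * (z1 - Complex.I * z2), ?_⟩
    simp only
    rw [mul_smul, sub_smul, mul_smul, h1, h2, smul_smul, Complex.I_mul_I, neg_one_smul]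
    have : a + star a - -(a - star a) = (2:ℂ) • a := by rw [two_smul]; abel
    rw [this, smul_smul]
    norm_num
  · rintro _ ⟨z, rfl⟩ g
    change γ.app g (z • (1:A)) = z • (1:A)
    rw [map_smul, StarAlgEquiv.map_one' (γ.app g)]
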